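/- arXiv:2306.05986 — 2 statements merged into one kernel-verified Lean document; each statement's English description precedes it below -/
import Mathlib

section
/- Let f_E : 2^N → ℤ be normalized supermodular on a finite set N, and let β₁ = max{⌈f_E(X)/|X|⌉ : ∅ ≠ X ⊆ N}. Let Φ be symmetric strictly convex and let z* minimize Φ over the Minkowski sum B_E = B̈_M + B̄_C where f_E = f_M + f_C. Then z*_i ≤ β₁ for all i ∈ N. -/
open Finset

/-- The M-convex set of an integer-valued supermodular function. -/
def MSet {N : Type*} [Fintype N] (f : Finset N → ℤ) : Set (N → ℤ) :=
  {x | (∑ i, x i) = f Finset.univ ∧ ∀ X : Finset N, f X ≤ ∑ i ∈ X, x i}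

/-- The base-polyhedron of an integer-valued supermodular function. -/
def basePoly {N : Type*} [Fintype N] (f : Finset N → ℤ) : Set (N → ℝ) :=
  {y | (∑ i, y i) = f Finset.univ ∧ ∀ X : Finset N, (f X : ℝ) ≤ ∑ i ∈ X, y i}

/-- The Minkowski sum `B_E = B̈_M + B̄_C` of possible utility vectors for mixed goods. -/
def BE {N : Type*} [Fintype N] (fM fC : Finset N → ℤ) : Set (N → ℝ) :=
  {z | ∃ x ∈ MSet fM, ∃ y ∈ basePoly fC, z = fun i => (x i : ℝ) + y i}

/-- A discrete sandwich theorem: an integer-valued modular function fits between a supermodular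
function and a submodular function dominating it. -/
theorem exists_modular_between {N : Type*} [Fintype N] [DecidableEq N] (S : Finset N) :
    ∀ f g : Finset N → ℤ, (∀ X Y, f X + f Y ≤ f (X ∪ Y) + f (X ∩ Y)) →
      (∀ X Y, g (X ∪ Y) + g (X ∩ Y) ≤ g X + g Y) → (∀ X, f X ≤ g X) → f ∅ = 0 → g ∅ = 0 →
      ∃ x : N → ℤ, ∀ X ⊆ S, f X ≤ ∑ i ∈ X, x i ∧ ∑ i ∈ X, x i ≤ g X := by
  induction S using Finset.induction_on with
  | empty =>
    intro f g _ _ _ hf0 hg0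
    refine ⟨0, fun X hX => ?_⟩
    rw [Finset.subset_empty.mp hX]
    simp [hf0, hg0]
  | insert e S he ih =>
    intro f g hf hg hfg hf0 hg0
    obtain ⟨X₀, -, hX₀⟩ := Finset.exists_max_image (Finset.univ : Finset (Finset N))
      (fun X => f (insert e X) - g (X.erase e)) ⟨∅, Finset.mem_univ _⟩
    set α := f (insert e X₀) - g (X₀.erase e) with hα
    have hlo : ∀ X, f (insert e X) - g (X.erase e) ≤ α := fun X => hX₀ X (Finset.mem_univ _)
    have h₁ : ∀ X Y : Finset N, insert e X ∪ Y.erase e = insert e (X ∪ Y) := by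
      intro X Y
      ext a
      simp only [Finset.mem_insert, Finset.mem_erase, Finset.mem_union]
      tauto
    have h₂ : ∀ X Y : Finset N, insert e X ∩ Y.erase e = (X ∩ Y).erase e := by
      intro X Y
      ext a
      simp only [Finset.mem_insert, Finset.mem_erase, Finset.mem_inter]
      tauto
    have h₃ : ∀ X Y : Finset N, X.erase e ∪ insert e Y = insert e (X ∪ Y) := by
      intro X Y
      ext a
      simp only [Finset.mem_insert, Finset.mem_erase, Finset.mem_union]
      tauto
    have h₄ : ∀ X Y : Finset N, X.erase e ∩ insert e Y = (X ∩ Y).erase e := by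
      intro X Y
      ext a
      simp only [Finset.mem_insert, Finset.mem_erase, Finset.mem_inter]
      tauto
    have h₅ : ∀ X Y : Finset N, X.erase e ∪ Y.erase e = (X ∪ Y).erase e := by
      intro X Y
      ext a
      simp only [Finset.mem_erase, Finset.mem_union]
      tauto
    have h₆ : ∀ X Y : Finset N, X.erase e ∩ Y.erase e = (X ∩ Y).erase e := by
      intro X Y
      ext a
      simp only [Finset.mem_erase, Finset.mem_inter]
      tauto
    have h₇ : ∀ X Y : Finset N, insert e X ∪ insert e Y = insert e (X ∪ Y) := by
      intro X Y
      ext a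
      simp only [Finset.mem_insert, Finset.mem_union]
      tauto
    have h₈ : ∀ X Y : Finset N, insert e X ∩ insert e Y = insert e (X ∩ Y) := by
      intro X Y
      ext a
      simp only [Finset.mem_insert, Finset.mem_inter]
      tauto
    have hup : ∀ Y, α ≤ g (insert e Y) - f (Y.erase e) := by
      intro Y
      have a := hf (insert e X₀) (Y.erase e)
      have b := hg (X₀.erase e) (insert e Y)
      rw [h₁, h₂] at a
      rw [h₃, h₄] at b
      have c := hfg (insert e (X₀ ∪ Y))
      have d := hfg ((X₀ ∩ Y).erase e)
      omega
    obtain ⟨x, hx⟩ := ih (fun X => max (f (X.erase e)) (f (insert e X) - α))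
      (fun X => min (g (X.erase e)) (g (insert e X) - α))
      (by
        intro X Y
        have a := hf (insert e X) (Y.erase e)
        have b := hf (X.erase e) (insert e Y)
        have c := hf (X.erase e) (Y.erase e)
        have d := hf (insert e X) (insert e Y)
        rw [h₁, h₂] at a
        rw [h₃, h₄] at b
        rw [h₅, h₆] at c
        rw [h₇, h₈] at d
        omega)
      (by
        intro X Y
        have a := hg (insert e X) (Y.erase e)
        have b := hg (X.erase e) (insert e Y)
        have c := hg (X.erase e) (Y.erase e)
        have d := hg (insert e X) (insert e Y)
        rw [h₁, h₂] at a
        rw [h₃, h₄] at b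
        rw [h₅, h₆] at c
        rw [h₇, h₈] at d
        omega)
      (by
        intro X
        have a := hlo X
        have b := hup X
        have c := hfg (X.erase e)
        have d := hfg (insert e X)
        omega)
      (by
        have a := hlo ∅
        simp only [Finset.erase_empty] at a ⊢
        omega)
      (by
        have a := hup ∅
        simp only [Finset.erase_empty] at a ⊢
        omega)
    refine ⟨Function.update x e α, fun X hX => ?_⟩
    have key := hx (X.erase e) (by
      intro a ha
      have := hX (Finset.mem_of_mem_erase ha)
      exact (Finset.mem_insert.mp this).resolve_left (Finset.ne_of_mem_erase ha))
    have hsum : ∑ i ∈ X.erase e, Function.update x e α i = ∑ i ∈ X.erase e, x i :=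
      Finset.sum_congr rfl fun i hi => Function.update_of_ne (Finset.ne_of_mem_erase hi) _ _
    by_cases heX : e ∈ X
    · rw [← Finset.add_sum_erase X _ heX, hsum, Function.update_self]
      simp only [Finset.erase_idem, Finset.insert_erase heX] at key
      omega
    · simp only [Finset.erase_eq_of_notMem heX] at key hsum
      rw [hsum]
      omega

theorem sum_transfer {N : Type*} [DecidableEq N] (z : N → ℝ) (i j : N) (t : ℝ) (X : Finset N) :
    ∑ k ∈ X, (z + Pi.single j t - Pi.single i t : N → ℝ) k =
      ∑ k ∈ X, z k + (if j ∈ X then t else 0) - (if i ∈ X then t else 0) := by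
  simp [Finset.sum_add_distrib, Finset.sum_sub_distrib]

/-- A symmetric strictly convex function strictly decreases under a transfer from a larger to a
smaller coordinate that does not swap the two. -/
theorem transfer_lt {N : Type*} [DecidableEq N] {Φ : (N → ℝ) → ℝ}
    (hsym : ∀ (σ : Equiv.Perm N) (z : N → ℝ), Φ (z ∘ σ) = Φ z)
    (hconv : StrictConvexOn ℝ Set.univ Φ) (z : N → ℝ) {i j : N} {t : ℝ} (ht : 0 < t)
    (htz : t < z i - z j) : Φ (z + Pi.single j t - Pi.single i t) < Φ z := by
  have hd : 0 < z i - z j := ht.trans htz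
  have hij : i ≠ j := by rintro rfl; simp at hd
  have hne : z ≠ z ∘ Equiv.swap i j := by
    intro h
    have := congrFun h i
    simp at this
    linarith
  have hl : t / (z i - z j) < 1 := (div_lt_one hd).mpr htz
  have key := hconv.2 (Set.mem_univ z) (Set.mem_univ (z ∘ Equiv.swap i j)) hne
    (show 0 < 1 - t / (z i - z j) by linarith) (div_pos ht hd) (by ring)
  rw [hsym] at key
  have heq : (1 - t / (z i - z j)) • z + (t / (z i - z j)) • (z ∘ Equiv.swap i j) =
      z + Pi.single j t - Pi.single i t := by
    ext k
    by_cases hki : k = i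
    · subst hki
      simp [hij]
      field_simp
      ring
    · by_cases hkj : k = j
      · subst hkj
        simp [hki]
        field_simp
        ring
      · simp [hki, hkj, Equiv.swap_apply_of_ne_of_ne hki hkj]
        ring
  rw [heq] at key
  simp only [smul_eq_mul] at key
  linarith

/-- If every upper level set of `u` has at least as large a sum under `z` as under `u`, then a
symmetric strictly convex function is smaller at `u` than at `z`. -/
theorem lt_of_levelSet_sum_le {N : Type*} [Fintype N] [DecidableEq N] {Φ : (N → ℝ) → ℝ}
    (hsym : ∀ (σ : Equiv.Perm N) (z : N → ℝ), Φ (z ∘ σ) = Φ z)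
    (hconv : StrictConvexOn ℝ Set.univ Φ) (u : N → ℝ) (z : N → ℝ)
    (htot : ∑ i, u i = ∑ i, z i)
    (hlev : ∀ c : ℝ, ∑ i with c ≤ u i, u i ≤ ∑ i with c ≤ u i, z i) (hne : u ≠ z) :
    Φ u < Φ z := by
  induction hn : #{k | u k ≠ z k} using Nat.strong_induction_on generalizing z with
  | _ n ih =>
  have hex : ∃ j, z j < u j := by
    by_contra! h
    exact hne (funext fun i =>
      (Finset.sum_eq_sum_iff_of_le fun i _ => h i).mp htot i (Finset.mem_univ i))
  obtain ⟨j, hj, hjmax⟩ := Finset.exists_max_image ({k | z k < u k} : Finset N) u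
    (by obtain ⟨j, hj⟩ := hex; exact ⟨j, by simpa using hj⟩)
  simp only [Finset.mem_filter, Finset.mem_univ, true_and] at hj hjmax
  have hexi : ∃ i, u j ≤ u i ∧ u i < z i := by
    by_contra! h
    have : ∑ i with u j ≤ u i, z i < ∑ i with u j ≤ u i, u i :=
      Finset.sum_lt_sum (fun i hi => h i (by simpa using hi)) ⟨j, by simp, hj⟩
    linarith [hlev (u j)]
  obtain ⟨i, hij, hi⟩ := hexi
  have hne' : i ≠ j := by rintro rfl; linarith
  set t := min (z i - u i) (u j - z j) with ht
  have ht0 : 0 < t := lt_min (by linarith) (by linarith)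
  have hti : t ≤ z i - u i := min_le_left _ _
  have htj : t ≤ u j - z j := min_le_right _ _
  have hlt := transfer_lt hsym hconv z ht0 (i := i) (j := j) (by linarith)
  set z' : N → ℝ := z + Pi.single j t - Pi.single i t with hz'
  have hzi : z' i = z i - t := by simp [hz', hne']
  have hzj : z' j = z j + t := by simp [hz', hne'.symm]
  have hzk : ∀ k, k ≠ i → k ≠ j → z' k = z k := by
    intro k h₁ h₂
    simp [hz', h₁, h₂]
  by_cases huz : u = z'
  · rw [huz]
    exact hlt
  refine (ih _ ?_ z' ?_ ?_ huz rfl).trans hlt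
  · rw [← hn]
    apply Finset.card_lt_card
    rw [Finset.ssubset_iff_of_subset]
    · rcases min_choice (z i - u i) (u j - z j) with h | h
      · exact ⟨i, by simpa using hi.ne, by
          simp only [Finset.mem_filter, Finset.mem_univ, true_and, not_not, hzi, ht, h]; ring⟩
      · exact ⟨j, by simpa using hj.ne', by
          simp only [Finset.mem_filter, Finset.mem_univ, true_and, not_not, hzj, ht, h]; ring⟩
    · intro k hk
      simp only [Finset.mem_filter, Finset.mem_univ, true_and] at hk ⊢
      by_cases h₁ : k = i
      · rw [h₁]; exact hi.ne
      · by_cases h₂ : k = j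
        · rw [h₂]; exact hj.ne'
        · rwa [hzk k h₁ h₂] at hk
  · rw [htot, hz', sum_transfer]
    simp
  · intro c
    by_cases hc : c ≤ u j
    · rw [hz', sum_transfer]
      simp only [Finset.mem_filter, Finset.mem_univ, true_and, hc, hc.trans hij, if_true]
      linarith [hlev c]
    · apply Finset.sum_le_sum
      intro k hk
      simp only [Finset.mem_filter, Finset.mem_univ, true_and] at hk
      have hkj : k ≠ j := by rintro rfl; exact hc hk
      by_cases h₁ : k = i
      · rw [h₁, hzi]; linarith
      · rw [hzk k h₁ hkj]
        by_contra! h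
        exact hc (hk.trans (hjmax k h))

/-- Tight sets at a point of the base polyhedron are closed under unions and intersections. -/
theorem tight_union_inter {N : Type*} [Fintype N] [DecidableEq N] {f : Finset N → ℤ}
    (hf : ∀ X Y : Finset N, f X + f Y ≤ f (X ∪ Y) + f (X ∩ Y)) {y : N → ℝ}
    (hy : y ∈ basePoly f) {X Y : Finset N} (hX : ∑ i ∈ X, y i = f X) (hY : ∑ i ∈ Y, y i = f Y) :
    ∑ i ∈ X ∪ Y, y i = f (X ∪ Y) ∧ ∑ i ∈ X ∩ Y, y i = f (X ∩ Y) := by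
  have a := hy.2 (X ∪ Y)
  have b := hy.2 (X ∩ Y)
  have c : (f X : ℝ) + f Y ≤ f (X ∪ Y) + f (X ∩ Y) := by exact_mod_cast hf X Y
  have d := Finset.sum_union_inter (s₁ := X) (s₂ := Y) (f := y)
  constructor <;> linarith

/-- At a minimizer of `y ↦ Φ (x + y)` over a base polyhedron, any set `A` on which `x + y` is
larger than off `A` is tight. -/
theorem tight_of_minimizer {N : Type*} [Fintype N] [DecidableEq N] {f : Finset N → ℤ}
    (hf : ∀ X Y : Finset N, f X + f Y ≤ f (X ∪ Y) + f (X ∩ Y)) (hf0 : f ∅ = 0)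
    {Φ : (N → ℝ) → ℝ} (hsym : ∀ (σ : Equiv.Perm N) (z : N → ℝ), Φ (z ∘ σ) = Φ z)
    (hconv : StrictConvexOn ℝ Set.univ Φ) (x y : N → ℝ) (hy : y ∈ basePoly f)
    (hmin : ∀ y' ∈ basePoly f, Φ (x + y) ≤ Φ (x + y')) (A : Finset N)
    (hA : ∀ i ∈ A, ∀ j ∉ A, x j + y j < x i + y i) : ∑ i ∈ A, y i = f A := by
  have hsep : ∀ i j, ∃ X : Finset N, i ∈ A → j ∈ Aᶜ →
      i ∈ X ∧ j ∉ X ∧ ∑ k ∈ X, y k = f X := by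
    intro i j
    by_contra! h
    have hiA := (h ∅).1
    have hjA : j ∉ A := Finset.mem_compl.mp (h ∅).2.1
    have hslack : ∀ X : Finset N, i ∈ X → j ∉ X → (f X : ℝ) < ∑ k ∈ X, y k :=
      fun X h₁ h₂ => lt_of_le_of_ne (hy.2 X) ((h X).2.2 h₁ h₂).symm
    have hij := hA i hiA j hjA
    obtain ⟨ε, hε, hεX⟩ : ∃ ε : ℝ, 0 < ε ∧
        ∀ X : Finset N, i ∈ X → j ∉ X → f X + ε ≤ ∑ k ∈ X, y k := by
      obtain ⟨X, hX, hXm⟩ := Finset.exists_min_image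
        ({X | i ∈ X ∧ j ∉ X} : Finset (Finset N)) (fun X => ∑ k ∈ X, y k - f X)
        ⟨A, by simpa using ⟨hiA, hjA⟩⟩
      simp only [Finset.mem_filter, Finset.mem_univ, true_and] at hX hXm
      exact ⟨∑ k ∈ X, y k - f X, by linarith [hslack X hX.1 hX.2],
        fun Y h₁ h₂ => by linarith [hXm Y ⟨h₁, h₂⟩]⟩
    set t := min ε ((x i + y i - (x j + y j)) / 2) with ht
    have ht0 : 0 < t := lt_min hε (by linarith)
    have ht1 : t ≤ ε := min_le_left _ _
    have ht2 : t ≤ (x i + y i - (x j + y j)) / 2 := min_le_right _ _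
    have hlt := transfer_lt hsym hconv (x + y) ht0 (i := i) (j := j)
      (by simp only [Pi.add_apply]; linarith)
    refine absurd (hmin (y + Pi.single j t - Pi.single i t) ⟨?_, fun X => ?_⟩) ?_
    · rw [sum_transfer]
      simpa using hy.1
    · rw [sum_transfer]
      have a := hy.2 X
      have b := hεX X
      split_ifs with h₁ h₂ h₂
      · linarith
      · linarith
      · linarith [b h₂ h₁]
      · linarith
    · rw [not_le]
      have : x + (y + Pi.single j t - Pi.single i t) = x + y + Pi.single j t - Pi.single i t := by
        rw [← add_sub_assoc, ← add_assoc]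
      rwa [this]
  choose X hX using hsep
  have hrow : ∀ i ∈ A, ∑ k ∈ Aᶜ.inf (X i), y k = f (Aᶜ.inf (X i)) := fun i hi =>
    Finset.inf_induction (p := fun S => ∑ k ∈ S, y k = f S) hy.1
      (fun S hS T hT => (tight_union_inter hf hy hS hT).2) fun j hj => (hX i j hi hj).2.2
  have hall : ∑ k ∈ A.sup fun i => Aᶜ.inf (X i), y k = f (A.sup fun i => Aᶜ.inf (X i)) :=
    Finset.sup_induction (p := fun S => ∑ k ∈ S, y k = f S) (by simp [hf0])
      (fun S hS T hT => (tight_union_inter hf hy hS hT).1) hrow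
  have hAeq : (A.sup fun i => Aᶜ.inf (X i)) = A := by
    ext k
    simp only [Finset.mem_sup, Finset.mem_inf]
    constructor
    · rintro ⟨i, hi, hk⟩
      by_contra hkA
      have hkA' := Finset.mem_compl.mpr hkA
      exact (hX i k hi hkA').2.1 (hk k hkA')
    · exact fun hk => ⟨k, hk, fun j hj => (hX k j hk hj).1⟩
  rwa [hAeq] at hall

theorem isCompact_basePoly {N : Type*} [Fintype N] [DecidableEq N] (f : Finset N → ℤ) :
    IsCompact (basePoly f) := by
  apply Metric.isCompact_of_isClosed_isBounded
  · have : basePoly f = {y : N → ℝ | ∑ i, y i = f Finset.univ} ∩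
        ⋂ X : Finset N, {y : N → ℝ | (f X : ℝ) ≤ ∑ i ∈ X, y i} := by
      ext y
      simp [basePoly]
    rw [this]
    exact (isClosed_eq (by fun_prop) (by fun_prop)).inter
      (isClosed_iInter fun X => isClosed_le (by fun_prop) (by fun_prop))
  · refine (Metric.isBounded_Icc (fun i => (f {i} : ℝ))
      (fun i => (f Finset.univ - f (Finset.univ.erase i) : ℝ))).subset ?_
    rintro y ⟨h₁, h₂⟩
    refine ⟨fun i => by simpa using h₂ {i}, fun i => ?_⟩
    have a := h₂ (Finset.univ.erase i)
    have b := Finset.add_sum_erase Finset.univ y (Finset.mem_univ i)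
    simp only
    linarith

theorem exists_minimizer_basePoly {N : Type*} [Fintype N] [DecidableEq N] {f : Finset N → ℤ}
    (hne : (basePoly f).Nonempty) {Φ : (N → ℝ) → ℝ} (hconv : StrictConvexOn ℝ Set.univ Φ)
    (x : N → ℝ) : ∃ y ∈ basePoly f, ∀ y' ∈ basePoly f, Φ (x + y) ≤ Φ (x + y') := by
  have hc : Continuous Φ := by
    rw [← continuousOn_univ]
    exact hconv.convexOn.continuousOn isOpen_univ
  exact (isCompact_basePoly f).exists_isMinOn hne
    (hc.comp (continuous_const.add continuous_id)).continuousOn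

/-- If the elements of `U` lie strictly above the level `β` at `x + y`, then one unit of `x` can be
moved out of `U` into the complement of `V`, up to the slack of `y` between `U` and `V`. -/
theorem exists_shifted_base {N : Type*} [Fintype N] [DecidableEq N] {fM fC : Finset N → ℤ}
    (hM : ∀ X Y : Finset N, fM X + fM Y ≤ fM (X ∪ Y) + fM (X ∩ Y)) (hM0 : fM ∅ = 0)
    (hC : ∀ X Y : Finset N, fC X + fC Y ≤ fC (X ∪ Y) + fC (X ∩ Y))
    {β : ℤ} (hub : ∀ X : Finset N, fM X + fC X ≤ β * #X) {x : N → ℤ} (hx : x ∈ MSet fM)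
    {y : N → ℝ} (hy : y ∈ basePoly fC) {U V : Finset N} (hUm : ∀ i, i ∈ U ↔ β < x i + y i)
    (hVm : ∀ i, i ∈ V ↔ β ≤ x i + y i) (hU : ∑ i ∈ U, y i = fC U) (hV : ∑ i ∈ V, y i = fC V)
    (hne : U.Nonempty) :
    ∃ x' ∈ MSet fM, ∀ X : Finset N, ((∑ i ∈ X, x' i : ℤ) : ℝ) ≤
      ((∑ i ∈ X, x i : ℤ) : ℝ) + ∑ i ∈ U ∪ X ∩ V, y i - fC (U ∪ X ∩ V)
        - (if U ⊆ X then 1 else 0) + (if X ⊆ V then 0 else 1) := by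
  have hUV : U ⊆ V := fun i hi => (hVm i).mpr ((hUm i).mp hi).le
  set w : N → ℤ := fun i => if i ∈ V \ U then β else x i with hw
  set g : Finset N → ℤ := fun X => ∑ i ∈ X, w i - fC (U ∪ X ∩ V) + fC U
    - (if U ⊆ X then 1 else 0) + (if X ⊆ V then 0 else 1) with hg
  have hsub : ∀ X Y, g (X ∪ Y) + g (X ∩ Y) ≤ g X + g Y := by
    intro X Y
    have a := hC (U ∪ X ∩ V) (U ∪ Y ∩ V)
    have e₁ : U ∪ X ∩ V ∪ (U ∪ Y ∩ V) = U ∪ (X ∪ Y) ∩ V := by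
      ext i
      simp only [Finset.mem_union, Finset.mem_inter]
      tauto
    have e₂ : (U ∪ X ∩ V) ∩ (U ∪ Y ∩ V) = U ∪ (X ∩ Y) ∩ V := by
      ext i
      simp only [Finset.mem_union, Finset.mem_inter]
      tauto
    rw [e₁, e₂] at a
    have b := Finset.sum_union_inter (s₁ := X) (s₂ := Y) (f := w)
    have c : (if U ⊆ X then 1 else 0) + (if U ⊆ Y then 1 else 0) ≤
        (if U ⊆ X ∪ Y then 1 else 0) + (if U ⊆ X ∩ Y then (1 : ℤ) else 0) := by
      have h₁ : U ⊆ X → U ⊆ X ∪ Y := fun h => h.trans Finset.subset_union_left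
      have h₂ : U ⊆ Y → U ⊆ X ∪ Y := fun h => h.trans Finset.subset_union_right
      have h₃ : U ⊆ X → U ⊆ Y → U ⊆ X ∩ Y := Finset.subset_inter
      split_ifs <;> first | omega | tauto
    have d : (if X ∪ Y ⊆ V then 0 else 1) + (if X ∩ Y ⊆ V then 0 else 1) ≤
        (if X ⊆ V then 0 else 1) + (if Y ⊆ V then 0 else (1 : ℤ)) := by
      have h₁ : X ⊆ V → X ∩ Y ⊆ V := fun h => Finset.inter_subset_left.trans h
      have h₂ : Y ⊆ V → X ∩ Y ⊆ V := fun h => Finset.inter_subset_right.trans h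
      have h₃ : X ⊆ V → Y ⊆ V → X ∪ Y ⊆ V := Finset.union_subset
      split_ifs <;> first | omega | tauto
    simp only [hg]
    linarith
  have hgR : ∀ X, (g X : ℝ) = ((∑ i ∈ X, x i : ℤ) : ℝ) + ∑ i ∈ U ∪ X ∩ V, y i
      - fC (U ∪ X ∩ V) - (if U ⊆ X then 1 else 0) + (if X ⊆ V then 0 else 1) := by
    intro X
    have hwR : ∀ i, (w i : ℝ) = x i + if i ∈ V \ U then y i else 0 := by
      intro i
      simp only [hw]
      split_ifs with h
      · rw [Finset.mem_sdiff, hUm, hVm] at h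
        linarith [h.1, not_lt.mp h.2]
      · simp
    have e : U ∪ X ∩ V = U ∪ X ∩ (V \ U) := by
      ext i
      simp only [Finset.mem_union, Finset.mem_inter, Finset.mem_sdiff]
      tauto
    have hdisj : Disjoint U (X ∩ (V \ U)) :=
      Finset.disjoint_left.mpr fun i hi hi' =>
        (Finset.mem_sdiff.mp (Finset.mem_inter.mp hi').2).2 hi
    have hs : ∑ i ∈ U ∪ X ∩ V, y i = fC U + ∑ i ∈ X ∩ (V \ U), y i := by
      rw [e, Finset.sum_union hdisj, hU]
    have hsw : ((∑ i ∈ X, w i : ℤ) : ℝ) = ((∑ i ∈ X, x i : ℤ) : ℝ) + ∑ i ∈ X ∩ (V \ U), y i := by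
      push_cast
      simp only [hwR, Finset.sum_add_distrib, Finset.sum_ite_mem]
    rw [hs]
    simp only [hg]
    push_cast at hsw ⊢
    rw [hsw]
    ring
  have hle : ∀ X, fM X ≤ g X := by
    intro X
    have a : (fM X : ℝ) ≤ ((∑ i ∈ X, x i : ℤ) : ℝ) := by exact_mod_cast hx.2 X
    have b := hy.2 (U ∪ X ∩ V)
    have c := hgR X
    by_cases h₁ : U ⊆ X
    · by_cases h₂ : X ⊆ V
      · have e : U ∪ X ∩ V = X := by
          rw [Finset.inter_eq_left.mpr h₂, Finset.union_eq_right.mpr h₁]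
        rw [if_pos h₁, if_pos h₂, e] at c
        have hlt : ∑ i ∈ X, (β : ℝ) < ∑ i ∈ X, ((x i : ℝ) + y i) := by
          obtain ⟨i, hi⟩ := hne
          exact Finset.sum_lt_sum (fun i hi => (hVm i).mp (h₂ hi)) ⟨i, h₁ hi, (hUm i).mp hi⟩
        rw [Finset.sum_const, nsmul_eq_mul, Finset.sum_add_distrib] at hlt
        have d : (fM X : ℝ) + fC X ≤ β * #X := by exact_mod_cast hub X
        have : (fM X : ℝ) < g X + 1 := by
          push_cast at c
          linarith
        exact Int.lt_add_one_iff.mp (by exact_mod_cast this)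
      · rw [if_pos h₁, if_neg h₂] at c
        have : (fM X : ℝ) ≤ g X := by linarith
        exact_mod_cast this
    · rw [if_neg h₁] at c
      have d : (0 : ℝ) ≤ if X ⊆ V then 0 else 1 := by split_ifs <;> norm_num
      have : (fM X : ℝ) ≤ g X := by linarith
      exact_mod_cast this
  have hg0 : g ∅ = 0 := by
    simp [hg, hne.ne_empty]
  obtain ⟨x', hx'⟩ := exists_modular_between Finset.univ fM g hM hsub hle hM0 hg0
  refine ⟨x', ⟨?_, fun X => (hx' X (Finset.subset_univ X)).1⟩, fun X => ?_⟩
  · refine le_antisymm ?_ (hx' _ subset_rfl).1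
    refine (hx' _ subset_rfl).2.trans ?_
    have a := hgR Finset.univ
    rw [hx.1, Finset.univ_inter, Finset.union_eq_right.mpr hUV, hV,
      if_pos (Finset.subset_univ U)] at a
    have d : (if Finset.univ ⊆ V then 0 else 1 : ℝ) ≤ 1 := by split_ifs <;> norm_num
    have : (g Finset.univ : ℝ) ≤ fM Finset.univ := by linarith
    exact_mod_cast this
  · rw [← hgR]
    exact_mod_cast (hx' X (Finset.subset_univ X)).2

theorem sum_const_lt_sum {N : Type*} {S : Finset N} {z : N → ℝ} {b : ℝ}
    (h : ∀ i ∈ S, b ≤ z i) (h' : ∃ i ∈ S, b < z i) : b * #S < ∑ i ∈ S, z i := by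
  have := Finset.sum_lt_sum h h'
  rwa [Finset.sum_const, nsmul_eq_mul, mul_comm] at this

theorem sum_lt_sum_const {N : Type*} {S : Finset N} {z : N → ℝ} {b : ℝ}
    (h : ∀ i ∈ S, z i ≤ b) (h' : ∃ i ∈ S, z i < b) : ∑ i ∈ S, z i < b * #S := by
  have := Finset.sum_lt_sum h h'
  rwa [Finset.sum_const, nsmul_eq_mul, mul_comm] at this

/-- every coordinate of a Φ-minimizer over `B_E` is at most
`β₁ = max{⌈f_E(X)/|X|⌉ : ∅ ≠ X ⊆ N}`. -/
theorem stmt_10 {N : Type*} [Fintype N] [DecidableEq N] [Nonempty N]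
    (fM fC : Finset N → ℤ)
    (hM : ∀ X Y : Finset N, fM X + fM Y ≤ fM (X ∪ Y) + fM (X ∩ Y)) (hM0 : fM ∅ = 0)
    (hC : ∀ X Y : Finset N, fC X + fC Y ≤ fC (X ∪ Y) + fC (X ∩ Y)) (hC0 : fC ∅ = 0)
    (β₁ : ℤ)
    (hub : ∀ X : Finset N, X.Nonempty → ⌈((fM X + fC X : ℚ)) / (X.card : ℚ)⌉ ≤ β₁)
    (hmax : ∃ X : Finset N, X.Nonempty ∧ β₁ = ⌈((fM X + fC X : ℚ)) / (X.card : ℚ)⌉)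
    (Φ : (N → ℝ) → ℝ)
    (hsym : ∀ (σ : Equiv.Perm N) (z : N → ℝ), Φ (z ∘ σ) = Φ z)
    (hconv : StrictConvexOn ℝ Set.univ Φ)
    (zs : N → ℝ) (hzs : zs ∈ BE fM fC)
    (hmin : ∀ z ∈ BE fM fC, Φ zs ≤ Φ z) :
    ∀ i : N, zs i ≤ (β₁ : ℝ) := by
  by_contra! hcon
  obtain ⟨x, hx, y, hy, hzxy⟩ := hzs
  have hzs' : zs = (fun i => (x i : ℝ)) + y := hzxy
  have hz : ∀ i, zs i = x i + y i := fun i => congrFun hzxy i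
  have hub' : ∀ X : Finset N, fM X + fC X ≤ β₁ * #X := by
    intro X
    rcases X.eq_empty_or_nonempty with rfl | hX
    · simp [hM0, hC0]
    · have a := Int.ceil_le.mp (hub X hX)
      rw [div_le_iff₀ (by exact_mod_cast hX.card_pos)] at a
      exact_mod_cast a
  have hopt : ∀ y' ∈ basePoly fC, Φ ((fun i => (x i : ℝ)) + y) ≤ Φ ((fun i => (x i : ℝ)) + y') := by
    intro y' hy'
    rw [← hzs']
    exact hmin _ ⟨x, hx, y', hy', rfl⟩
  have htight := tight_of_minimizer hC hC0 hsym hconv _ y hy hopt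
  set U : Finset N := {i | (β₁ : ℝ) < x i + y i} with hUdef
  set V : Finset N := {i | (β₁ : ℝ) ≤ x i + y i} with hVdef
  have hUm : ∀ i, i ∈ U ↔ (β₁ : ℝ) < x i + y i := by simp [hUdef]
  have hVm : ∀ i, i ∈ V ↔ (β₁ : ℝ) ≤ x i + y i := by simp [hVdef]
  have hUV : U ⊆ V := fun i hi => (hVm i).mpr ((hUm i).mp hi).le
  have hU : ∑ i ∈ U, y i = fC U := htight U fun i hi j hj => by
    rw [hUm] at hi hj
    linarith
  have hV : ∑ i ∈ V, y i = fC V := htight V fun i hi j hj => by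
    rw [hVm] at hi hj
    linarith
  have hUne : U.Nonempty := by
    obtain ⟨i, hi⟩ := hcon
    exact ⟨i, by rwa [hUm, ← hz]⟩
  obtain ⟨x', hx', hR⟩ := exists_shifted_base hM hM0 hC hub' hx hy hUm hVm hU hV hUne
  obtain ⟨y', hy', hopt'⟩ := exists_minimizer_basePoly ⟨y, hy⟩ hconv (fun i => (x' i : ℝ))
  have htight' := tight_of_minimizer hC hC0 hsym hconv _ y' hy' hopt'
  push_cast at hR
  have hCR : ∀ X Y : Finset N, (fC X : ℝ) + fC Y ≤ fC (X ∪ Y) + fC (X ∩ Y) :=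
    fun X Y => by exact_mod_cast hC X Y
  have hlower : ∀ i ∈ V, (β₁ : ℝ) ≤ x' i + y' i := by
    by_contra! h
    set A : Finset N := {i | (β₁ : ℝ) ≤ x' i + y' i} with hA
    have hAm : ∀ i, i ∈ A ↔ (β₁ : ℝ) ≤ x' i + y' i := by simp [hA]
    have hAt : ∑ i ∈ A, y' i = fC A := htight' A fun i hi j hj => by
      rw [hAm] at hi hj
      linarith
    have hS : ∑ i ∈ V \ A, ((x' i : ℝ) + y' i) < β₁ * #(V \ A) := by
      obtain ⟨i, hi, hi'⟩ := h
      have : ∀ i ∈ V \ A, (x' i : ℝ) + y' i < β₁ := fun i hi => by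
        rw [Finset.mem_sdiff, hAm, not_le] at hi
        exact hi.2
      have hiS : i ∈ V \ A := by
        rw [Finset.mem_sdiff, hAm, not_le]
        exact ⟨hi, hi'⟩
      exact sum_lt_sum_const (fun i hi => (this i hi).le) ⟨i, hiS, this i hiS⟩
    rw [Finset.sum_add_distrib] at hS
    have hVc := hR Vᶜ
    have e₁ : U ∪ Vᶜ ∩ V = U := by
      rw [Finset.inter_comm, Finset.inter_compl, Finset.union_empty]
    have e₂ : ¬ U ⊆ Vᶜ := fun h => by
      obtain ⟨i, hi⟩ := hUne
      exact Finset.mem_compl.mp (h hi) (hUV hi)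
    have e₃ : (if Vᶜ ⊆ V then 0 else 1 : ℝ) ≤ 1 := by split_ifs <;> norm_num
    rw [e₁, if_neg e₂, hU] at hVc
    have s₁ := Finset.sum_add_sum_compl V (fun i => (x i : ℝ))
    have s₂ := Finset.sum_add_sum_compl V (fun i => (x' i : ℝ))
    have s₃ : ∑ i, (x i : ℝ) = ∑ i, (x' i : ℝ) := by exact_mod_cast hx.1.trans hx'.1.symm
    have hX := hR (V ∩ A)
    have e₄ : V ∩ A ∩ V = V ∩ A := Finset.inter_eq_left.mpr Finset.inter_subset_left
    rw [e₄, if_pos (Finset.inter_subset_left : V ∩ A ⊆ V)] at hX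
    have s₄ := Finset.sum_inter_add_sum_sdiff V A (fun i => (x i : ℝ))
    have s₅ := Finset.sum_inter_add_sum_sdiff V A (fun i => (x' i : ℝ))
    have s₆ := Finset.sum_inter_add_sum_sdiff V A y
    have s₇ := Finset.sum_union_inter (s₁ := U) (s₂ := V ∩ A) (f := y)
    have s₈ := Finset.sum_union_inter (s₁ := V) (s₂ := A) (f := y')
    have s₉ := Finset.sum_inter_add_sum_sdiff V A y'
    have c₁ := hCR U (V ∩ A)
    have c₂ := hCR V A
    have c₃ := hy.2 (U ∩ (V ∩ A))
    have c₄ := hy'.2 (V ∪ A)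
    have hlo : ∑ i ∈ V \ A, ((x i : ℝ) + y i) - 1 + (if U ⊆ V ∩ A then 1 else 0) ≤
        ∑ i ∈ V \ A, (x' i : ℝ) + fC V - fC (V ∩ A) := by
      rw [Finset.sum_add_distrib]
      linarith
    have hhi : ∑ i ∈ V \ A, (x' i : ℝ) + fC V - fC (V ∩ A) < β₁ * #(V \ A) := by
      linarith
    have hgt : (β₁ : ℝ) * #(V \ A) <
        ∑ i ∈ V \ A, ((x i : ℝ) + y i) + (if U ⊆ V ∩ A then 1 else 0) := by
      have hge : ∀ i ∈ V \ A, (β₁ : ℝ) ≤ x i + y i :=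
        fun i hi => (hVm i).mp (Finset.mem_sdiff.mp hi).1
      split_ifs with h₁
      · have := Finset.card_nsmul_le_sum _ _ _ hge
        rw [nsmul_eq_mul] at this
        linarith
      · obtain ⟨i, hi, hi'⟩ := Finset.not_subset.mp h₁
        have := sum_const_lt_sum hge ⟨i, Finset.mem_sdiff.mpr
          ⟨hUV hi, fun h => hi' (Finset.mem_inter.mpr ⟨hUV hi, h⟩)⟩, (hUm i).mp hi⟩
        linarith
    have hhi' : ∑ i ∈ V \ A, x' i + fC V - fC (V ∩ A) < β₁ * #(V \ A) := by exact_mod_cast hhi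
    have hlo' : β₁ * #(V \ A) < ∑ i ∈ V \ A, x' i + fC V - fC (V ∩ A) + 1 := by
      have : (β₁ : ℝ) * #(V \ A) < ∑ i ∈ V \ A, (x' i : ℝ) + fC V - fC (V ∩ A) + 1 := by
        linarith
      exact_mod_cast this
    omega
  have hupper : ∀ i, (β₁ : ℝ) < x' i + y' i → i ∈ U := by
    by_contra! h
    set A : Finset N := {i | (β₁ : ℝ) < x' i + y' i} with hA
    have hAm : ∀ i, i ∈ A ↔ (β₁ : ℝ) < x' i + y' i := by simp [hA]
    have hAt : ∑ i ∈ A, y' i = fC A := htight' A fun i hi j hj => by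
      rw [hAm] at hi hj
      linarith
    have hS : β₁ * #(A \ U) < ∑ i ∈ A \ U, ((x' i : ℝ) + y' i) := by
      obtain ⟨i, hi, hi'⟩ := h
      have : ∀ i ∈ A \ U, (β₁ : ℝ) < x' i + y' i := fun i hi =>
        (hAm i).mp (Finset.mem_sdiff.mp hi).1
      have hiS : i ∈ A \ U := Finset.mem_sdiff.mpr ⟨(hAm i).mpr hi, hi'⟩
      exact sum_const_lt_sum (fun i hi => (this i hi).le) ⟨i, hiS, this i hiS⟩
    rw [Finset.sum_add_distrib] at hS
    have hX := hR (A \ U)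
    have e₂ : ¬ U ⊆ A \ U := fun h => by
      obtain ⟨i, hi⟩ := hUne
      exact (Finset.mem_sdiff.mp (h hi)).2 hi
    have e₁ : U ∪ A \ U ∩ V = (A ∪ U) ∩ V := by
      ext i
      have := @hUV i
      simp only [Finset.mem_union, Finset.mem_inter, Finset.mem_sdiff]
      tauto
    have e₃ : (A ∪ U) \ U = A \ U := Finset.union_sdiff_right A U
    rw [if_neg e₂, e₁] at hX
    have s₁ := Finset.sum_union_inter (s₁ := A ∪ U) (s₂ := V) (f := y)
    have s₂ := Finset.sum_sdiff (Finset.subset_union_right : U ⊆ A ∪ U) (f := y)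
    have s₃ := Finset.sum_inter_add_sum_sdiff A U y'
    rw [e₃] at s₂
    have c₁ := hCR A U
    have c₂ := hCR (A ∪ U) V
    have c₃ := hy.2 (A ∪ U ∪ V)
    have c₄ := hy'.2 (A ∩ U)
    have hhi : ∑ i ∈ A \ U, (x' i : ℝ) + fC (A ∪ U) - fC U ≤
        ∑ i ∈ A \ U, ((x i : ℝ) + y i) + (if A \ U ⊆ V then 0 else 1) := by
      rw [Finset.sum_add_distrib]
      linarith
    have hlo : (β₁ : ℝ) * #(A \ U) < ∑ i ∈ A \ U, (x' i : ℝ) + fC (A ∪ U) - fC U := by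
      linarith
    have hlt : ∑ i ∈ A \ U, ((x i : ℝ) + y i) + (if A \ U ⊆ V then 0 else 1) <
        β₁ * #(A \ U) + 1 := by
      have hle : ∀ i ∈ A \ U, (x i : ℝ) + y i ≤ β₁ := fun i hi =>
        not_lt.mp fun h => (Finset.mem_sdiff.mp hi).2 ((hUm i).mpr h)
      split_ifs with h₁
      · have := Finset.sum_le_card_nsmul _ _ _ hle
        rw [nsmul_eq_mul] at this
        linarith
      · obtain ⟨i, hi, hi'⟩ := Finset.not_subset.mp h₁
        have := sum_lt_sum_const hle ⟨i, hi, not_le.mp fun h => hi' ((hVm i).mpr h)⟩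
        linarith
    have hlo' : β₁ * #(A \ U) < ∑ i ∈ A \ U, x' i + fC (A ∪ U) - fC U := by exact_mod_cast hlo
    have hhi' : ∑ i ∈ A \ U, x' i + fC (A ∪ U) - fC U < β₁ * #(A \ U) + 1 := by
      have := hhi.trans_lt hlt
      exact_mod_cast this
    omega
  have hlt : Φ (fun i => (x' i : ℝ) + y' i) < Φ zs := by
    refine lt_of_levelSet_sum_le hsym hconv _ _ ?_ ?_ ?_
    · simp only [hz, Finset.sum_add_distrib]
      rw [hy.1, hy'.1]
      congr 1
      exact_mod_cast hx'.1.trans hx.1.symm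
    · intro c
      set A : Finset N := {i | c ≤ x' i + y' i} with hA
      have hAm : ∀ i, i ∈ A ↔ c ≤ x' i + y' i := by simp [hA]
      have hAt : ∑ i ∈ A, y' i = fC A := htight' A fun i hi j hj => by
        rw [hAm] at hi hj
        linarith
      simp only [hz, Finset.sum_add_distrib, hAt]
      have a := hR A
      have b := hy.2 A
      by_cases hc : c ≤ β₁
      · have hVA : V ⊆ A := fun i hi => (hAm i).mpr (hc.trans (hlower i hi))
        rw [Finset.inter_eq_right.mpr hVA, Finset.union_eq_right.mpr hUV, hV,
          if_pos (hUV.trans hVA)] at a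
        have d : (if A ⊆ V then 0 else 1 : ℝ) ≤ 1 := by split_ifs <;> norm_num
        linarith
      · have hAU : A ⊆ U := fun i hi => hupper i ((not_le.mp hc).trans_le ((hAm i).mp hi))
        rw [Finset.union_eq_left.mpr (Finset.inter_subset_left.trans hAU), hU,
          if_pos (hAU.trans hUV)] at a
        have d : (0 : ℝ) ≤ if U ⊆ A then 1 else 0 := by split_ifs <;> norm_num
        linarith
    · intro h
      have hu : ∀ i, (x' i : ℝ) + y' i = x i + y i := fun i => (congrFun h i).trans (hz i)
      have hVt : ∑ i ∈ V, y' i = fC V := htight' V fun i hi j hj => by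
        rw [hVm, ← hu] at hi hj
        linarith
      have a := hR V
      rw [Finset.inter_self, Finset.union_eq_right.mpr hUV, hV, if_pos hUV,
        if_pos subset_rfl] at a
      have b := Finset.sum_congr (rfl : V = V) fun i _ => hu i
      rw [Finset.sum_add_distrib, Finset.sum_add_distrib] at b
      linarith
  exact absurd (hmin _ ⟨x', hx', y', hy', rfl⟩) (not_le.mpr hlt)
end

section
/- (Proximity theorem) Let f_M, f_C : 2^N → ℤ be normalized supermodular, B̈_M the M-convex set of f_M, B̄_C the base-polyhedron of f_C, B_E = B̈_M + B̄_C (Minkowski sum), and B̄_E the convex hull of B_E. Let Φ be symmetric strictly convex. Then for any z* ∈ argmin_{z ∈ B_E} Φ(z) and the (unique) z̄ ∈ argmin_{z ∈ B̄_E} Φ(z), it holds that ⌊z̄_i⌋ ≤ z*_i ≤ ⌈z̄_i⌉ for all i ∈ N. -/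
open Finset

namespace BasePolyhedron

variable {N : Type*} [Fintype N] [DecidableEq N]

/-- Supermodularity of an integer-valued set function. -/
def Supermodular (f : Finset N → ℤ) : Prop :=
  ∀ X Y : Finset N, f X + f Y ≤ f (X ∪ Y) + f (X ∩ Y)

/-- The inequality indexed by `X` holds with equality at `y`. -/
def Tight (f : Finset N → ℤ) (y : N → ℝ) (X : Finset N) : Prop :=
  ∑ i ∈ X, y i = f X

/-- The dual set function, whose base polyhedron is the negative of that of `f`. -/
def dual (f : Finset N → ℤ) (X : Finset N) : ℤ := f Xᶜ - f univ

variable {f g : Finset N → ℤ} {y y' z z' : N → ℝ} {X Y T U : Finset N}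

omit [Fintype N] in
lemma Supermodular.slack_add_le (hf : Supermodular f) (y : N → ℝ) (X Y : Finset N) :
    (∑ i ∈ X ∪ Y, y i - f (X ∪ Y)) + (∑ i ∈ X ∩ Y, y i - f (X ∩ Y)) ≤
      (∑ i ∈ X, y i - f X) + (∑ i ∈ Y, y i - f Y) := by
  have h := sum_union_inter (s₁ := X) (s₂ := Y) (f := y)
  have h2 : (f X : ℝ) + f Y ≤ f (X ∪ Y) + f (X ∩ Y) := by exact_mod_cast hf X Y
  linarith

lemma Tight.union_inter (hf : Supermodular f) (hy : y ∈ basePoly f)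
    (hX : Tight f y X) (hY : Tight f y Y) : Tight f y (X ∪ Y) ∧ Tight f y (X ∩ Y) := by
  have h := hf.slack_add_le y X Y
  have h1 := hy.2 (X ∪ Y)
  have h2 := hy.2 (X ∩ Y)
  unfold Tight at *
  constructor <;> linarith

omit [DecidableEq N] in
lemma tight_univ (hy : y ∈ basePoly f) : Tight f y univ := hy.1

omit [Fintype N] [DecidableEq N] in
lemma tight_empty (hf0 : f ∅ = 0) : Tight f y ∅ := by simp [Tight, hf0]

lemma tight_biUnion {ι : Type*} (hf : Supermodular f) (hf0 : f ∅ = 0) (hy : y ∈ basePoly f)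
    (s : Finset ι) (D : ι → Finset N) (hD : ∀ i ∈ s, Tight f y (D i)) :
    Tight f y (s.biUnion D) := by
  classical
  induction s using Finset.induction_on with
  | empty => simpa using tight_empty hf0
  | insert i s _ ih =>
    rw [biUnion_insert]
    exact (Tight.union_inter hf hy (hD i (mem_insert_self _ _))
      (ih fun k hk => hD k (mem_insert_of_mem hk))).1

lemma tight_inf {ι : Type*} (hf : Supermodular f) (hy : y ∈ basePoly f)
    (s : Finset ι) (D : ι → Finset N) (hD : ∀ i ∈ s, Tight f y (D i)) :
    Tight f y (s.inf D) := by
  classical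
  induction s using Finset.induction_on with
  | empty => simpa using tight_univ hy
  | insert i s _ ih =>
    rw [inf_insert]
    exact (Tight.union_inter hf hy (hD i (mem_insert_self _ _))
      (ih fun k hk => hD k (mem_insert_of_mem hk))).2

/-- A set is tight as soon as tight sets separate its members from its nonmembers. -/
lemma tight_of_separated (hf : Supermodular f) (hf0 : f ∅ = 0) (hy : y ∈ basePoly f)
    (V : Finset N) (hV : ∀ p ∈ V, ∀ q ∉ V, ∃ X, Tight f y X ∧ p ∈ X ∧ q ∉ X) :
    Tight f y V := by
  have h1 : ∀ p ∈ V, ∃ X, Tight f y X ∧ p ∈ X ∧ X ⊆ V := by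
    intro p hp
    choose! D hD using hV p hp
    refine ⟨Vᶜ.inf D, tight_inf hf hy _ _ fun q hq => (hD q (by simpa using hq)).1, ?_, ?_⟩
    · simp only [mem_inf, mem_compl]
      exact fun q hq => (hD q hq).2.1
    · intro q hq
      by_contra hqV
      simp only [mem_inf, mem_compl] at hq
      exact (hD q hqV).2.2 (hq q hqV)
  choose! D hD using h1
  have : V = V.biUnion D := by
    ext q
    simp only [mem_biUnion]
    exact ⟨fun hq => ⟨q, hq, (hD q hq).2.1⟩, fun ⟨p, hp, hq⟩ => (hD p hp).2.2 hq⟩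
  rw [this]
  exact tight_biUnion hf hf0 hy _ _ fun p hp => (hD p hp).1

omit [Fintype N] in
lemma sum_transfer (y : N → ℝ) (p q : N) (ε : ℝ) (X : Finset N) :
    ∑ k ∈ X, (y - Pi.single p ε + Pi.single q ε : N → ℝ) k =
      ∑ k ∈ X, y k - (if p ∈ X then ε else 0) + (if q ∈ X then ε else 0) := by
  simp only [Pi.add_apply, Pi.sub_apply, sum_add_distrib, sum_sub_distrib, sum_pi_single']

lemma transfer_mem (hy : y ∈ basePoly f) {p q : N} {ε : ℝ} (hε : 0 ≤ ε)
    (h : ∀ X : Finset N, p ∈ X → q ∉ X → ε ≤ ∑ k ∈ X, y k - f X) :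
    y - Pi.single p ε + Pi.single q ε ∈ basePoly f := by
  refine ⟨?_, fun X => ?_⟩
  · rw [sum_transfer]
    simpa using hy.1
  · rw [sum_transfer]
    have h1 := hy.2 X
    have h2 := h X
    split_ifs with hp hq hq
    · linarith
    · have := h2 hp hq
      linarith
    · linarith
    · linarith

lemma exists_pos_le_slack (hy : y ∈ basePoly f) {p q : N}
    (h : ¬ ∃ X, Tight f y X ∧ p ∈ X ∧ q ∉ X) :
    ∃ ε : ℝ, 0 < ε ∧ ∀ X : Finset N, p ∈ X → q ∉ X → ε ≤ ∑ k ∈ X, y k - f X := by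
  classical
  rcases (univ.filter fun X : Finset N => p ∈ X ∧ q ∉ X).eq_empty_or_nonempty with he | hne
  · refine ⟨1, one_pos, fun X hp hq => ?_⟩
    have : X ∈ univ.filter fun X : Finset N => p ∈ X ∧ q ∉ X := by simp [hp, hq]
    rw [he] at this
    simp at this
  · obtain ⟨X, hX, hmin⟩ := exists_min_image _ (fun X => ∑ k ∈ X, y k - (f X : ℝ)) hne
    simp only [mem_filter, mem_univ, true_and] at hX hmin
    refine ⟨_, ?_, fun Y hp hq => hmin Y ⟨hp, hq⟩⟩
    rcases (hy.2 X).lt_or_eq with hlt | heq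
    · linarith
    · exact absurd ⟨X, heq.symm, hX⟩ h

/-- Two points of a base polyhedron can be glued along a common tight set. -/
lemma piecewise_mem (hf : Supermodular f) (hy : y ∈ basePoly f) (hy' : y' ∈ basePoly f)
    (hT : Tight f y T) (hT' : Tight f y' T) : T.piecewise y y' ∈ basePoly f := by
  have key : ∀ X, ∑ k ∈ X, T.piecewise y y' k =
      ∑ k ∈ X ∩ T, y k + (∑ k ∈ X ∪ T, y' k - ∑ k ∈ T, y' k) := by
    intro X
    rw [sum_piecewise, ← sum_sdiff (s₁ := T) (s₂ := X ∪ T) subset_union_right,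
      union_sdiff_right]
    ring
  unfold Tight at hT hT'
  refine ⟨?_, fun X => ?_⟩
  · rw [key, univ_inter, union_eq_left.2 (subset_univ T), hT, hT', hy'.1]
    ring
  · rw [key, hT']
    have h1 := hy.2 (X ∩ T)
    have h2 := hy'.2 (X ∪ T)
    have h3 : (f X : ℝ) + f T ≤ f (X ∪ T) + f (X ∩ T) := by exact_mod_cast hf X T
    linarith

omit [Fintype N] [DecidableEq N] in
lemma Tight.congr_on (h : Tight f y T) (he : ∀ k ∈ T, y' k = y k) : Tight f y' T := by
  unfold Tight at *
  rw [← h]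
  exact sum_congr rfl he

lemma Tight.congr_off (h : Tight f y T) (hy : y ∈ basePoly f) (hy' : y' ∈ basePoly f)
    (he : ∀ k ∉ T, y' k = y k) : Tight f y' T := by
  have h1 := sum_add_sum_compl T y
  have h2 := sum_add_sum_compl T y'
  have h3 : ∑ k ∈ Tᶜ, y' k = ∑ k ∈ Tᶜ, y k := sum_congr rfl fun k hk => he k (by simpa using hk)
  have h4 := hy.1
  have h5 := hy'.1
  unfold Tight at *
  linarith

/-- A unit exchange is possible between integral coordinates not separated by a tight set. -/
lemma unit_transfer_mem (hf : Supermodular f) (hy : y ∈ basePoly f)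
    (hT : Tight f y T) (hU : Tight f y U) (hTU : T ⊆ U)
    (hint : ∀ k ∈ U, k ∉ T → ∃ n : ℤ, y k = n) {p q : N}
    (hp : p ∈ U) (hqT : q ∉ T) (h : ¬ ∃ X, Tight f y X ∧ p ∈ X ∧ q ∉ X) :
    y - Pi.single p 1 + Pi.single q 1 ∈ basePoly f := by
  refine transfer_mem hy zero_le_one fun X hpX hqX => ?_
  have h1 := hf.slack_add_le y X T
  have h2 := hf.slack_add_le y (X ∪ T) U
  have h3 := hy.2 (X ∩ T)
  have h4 := hy.2 (X ∪ T ∪ U)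
  set Y := (X ∪ T) ∩ U with hY
  have hpY : p ∈ Y := by simp [hY, hpX, hp]
  have hqY : q ∉ Y := by simp [hY, hqX, hqT]
  have hTY : T ⊆ Y := subset_inter subset_union_right hTU
  have hs : ∃ n : ℤ, ∑ k ∈ Y, y k = n := by
    choose! m hm using hint
    refine ⟨∑ k ∈ Y \ T, m k + f T, ?_⟩
    rw [← sum_sdiff hTY, hT]
    push_cast
    congr 1
    refine sum_congr rfl fun k hk => ?_
    rw [mem_sdiff] at hk
    exact hm k (mem_inter.1 hk.1).2 hk.2
  obtain ⟨n, hn⟩ := hs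
  have h5 : f Y < n := by
    have h6 := hy.2 Y
    rw [hn] at h6
    rcases (Int.cast_le.1 h6).lt_or_eq with hlt | heq
    · exact hlt
    · exact absurd ⟨Y, by rw [Tight, hn, heq], hpY, hqY⟩ h
  have h6 : (f Y : ℝ) + 1 ≤ n := by exact_mod_cast h5
  unfold Tight at hT hU
  linarith

lemma dual_supermodular (hf : Supermodular f) : Supermodular (dual f) := by
  intro X Y
  have := hf Xᶜ Yᶜ
  simp only [dual, compl_union, compl_inter]
  linarith

lemma dual_empty : dual f ∅ = 0 := by simp [dual]

lemma dual_univ (hf0 : f ∅ = 0) : dual f univ = -f univ := by simp [dual, hf0]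

lemma dual_dual (hf0 : f ∅ = 0) : dual (dual f) = f := by
  funext X
  simp [dual, hf0]

lemma neg_mem_dual (hf0 : f ∅ = 0) (hy : y ∈ basePoly f) : -y ∈ basePoly (dual f) := by
  refine ⟨?_, fun X => ?_⟩
  · simp [dual_univ hf0, hy.1]
  · have h := hy.2 Xᶜ
    have h1 := sum_add_sum_compl X y
    have h2 := hy.1
    simp only [Pi.neg_apply, sum_neg_distrib, dual]
    push_cast
    linarith

lemma Tight.neg_compl (hy : y ∈ basePoly f) (h : Tight f y X) : Tight (dual f) (-y) Xᶜ := by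
  have h1 := sum_add_sum_compl X y
  have h2 := hy.1
  unfold Tight at *
  simp only [Pi.neg_apply, sum_neg_distrib, dual, compl_compl]
  push_cast
  linarith

omit [DecidableEq N] in
lemma isCompact_box_inter (f : Finset N → ℤ) (l u : N → ℝ) :
    IsCompact (basePoly f ∩ Set.Icc l u) := by
  refine IsCompact.inter_left isCompact_Icc ?_
  have : basePoly f = {y : N → ℝ | (∑ i, y i) = f univ} ∩
      ⋂ X : Finset N, {y : N → ℝ | (f X : ℝ) ≤ ∑ i ∈ X, y i} := by
    ext y
    simp [basePoly]
  rw [this]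
  refine IsClosed.inter (isClosed_eq (by fun_prop) (by fun_prop)) (isClosed_iInter fun X => ?_)
  exact isClosed_le (by fun_prop) (by fun_prop)

/-- Inside a tight set whose coordinates of `c + y` exceed the integer `a`, one can raise
coordinate `i` to level `a + 1` by lowering the others, all staying above level `a`. -/
lemma exists_raise (hf : Supermodular f) (hf0 : f ∅ = 0) (hy : y ∈ basePoly f)
    (hT : Tight f y T) (c : N → ℤ) (a : ℤ) (ha : ∀ k ∈ T, (a : ℝ) < c k + y k)
    {i : N} (hi : i ∈ T) :
    ∃ y' ∈ basePoly f, (∀ k ∉ T, y' k = y k) ∧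
      (∀ k ∈ T, k ≠ i → (a : ℝ) ≤ c k + y' k ∧ y' k ≤ y k) ∧
      (a : ℝ) + 1 ≤ c i + y' i ∧ y' i < y i + 1 := by
  classical
  set l : N → ℝ := fun k => if k = i then y k else if k ∈ T then (a : ℝ) - c k else y k with hl
  set u : N → ℝ := fun k => if k = i then max ((a : ℝ) + 1 - c i) (y i) else y k with hu
  have hmem : y ∈ basePoly f ∩ Set.Icc l u := by
    refine ⟨hy, fun k => ?_, fun k => ?_⟩
    · simp only [hl]
      split_ifs with h1 h2
      · exact le_rfl
      · have := ha k h2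
        linarith
      · exact le_rfl
    · simp only [hu]
      split_ifs with h1
      · rw [h1]
        exact le_max_right _ _
      · exact le_rfl
  obtain ⟨w, ⟨hw, hlw, hwu⟩, hmax⟩ := (isCompact_box_inter f l u).exists_isMaxOn ⟨y, hmem⟩
    (f := fun w : N → ℝ => w i) (by fun_prop)
  have hwoff : ∀ k ∉ T, w k = y k := by
    intro k hk
    have hki : k ≠ i := fun h => hk (h ▸ hi)
    have h1 := hlw k
    have h2 := hwu k
    simp only [hl, hu, if_neg hki, if_neg hk] at h1 h2
    exact le_antisymm h2 h1
  have hwon : ∀ k ∈ T, k ≠ i → (a : ℝ) ≤ c k + w k ∧ w k ≤ y k := by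
    intro k hk hki
    have h1 := hlw k
    have h2 := hwu k
    simp only [hl, hu, if_neg hki, if_pos hk] at h1 h2
    exact ⟨by linarith, h2⟩
  have hwi : y i ≤ w i ∧ w i ≤ max ((a : ℝ) + 1 - c i) (y i) := by
    have h1 := hlw i
    have h2 := hwu i
    simpa only [hl, hu, if_true] using And.intro h1 h2
  refine ⟨w, hw, hwoff, hwon, ?_, ?_⟩
  swap
  · refine hwi.2.trans_lt (max_lt ?_ (by linarith))
    have := ha i hi
    linarith
  by_contra! hlt
  have hTw : Tight f w T := hT.congr_off hy hw hwoff
  have hsep : ∀ k ∈ T.filter (fun k => k ≠ i ∧ (a : ℝ) < c k + w k),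
      ∃ X, Tight f w X ∧ k ∈ X ∧ i ∉ X := by
    intro k hk
    rw [mem_filter] at hk
    obtain ⟨hkT, hki, hka⟩ := hk
    by_contra hno
    obtain ⟨ε, hε, hεX⟩ := exists_pos_le_slack hw hno
    set δ := min ε (min (c k + w k - a) ((a : ℝ) + 1 - (c i + w i))) with hδ
    have hδ0 : 0 < δ := lt_min hε (lt_min (by linarith) (by linarith))
    have hδ1 : δ ≤ ε := min_le_left _ _
    have hδ2 : δ ≤ c k + w k - a := (min_le_right _ _).trans (min_le_left _ _)
    have hδ3 : δ ≤ (a : ℝ) + 1 - (c i + w i) := (min_le_right _ _).trans (min_le_right _ _)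
    have hm : w - Pi.single k δ + Pi.single i δ ∈ basePoly f :=
      transfer_mem hw hδ0.le fun X h1 h2 => hδ1.trans (hεX X h1 h2)
    have hbox : w - Pi.single k δ + Pi.single i δ ∈ Set.Icc l u := by
      constructor
      · intro m
        have h1 := hlw m
        by_cases hmi : m = i
        · subst hmi
          simp only [Pi.add_apply, Pi.sub_apply, Pi.single_eq_same, Pi.single_eq_of_ne hki.symm]
          linarith
        · by_cases hmk : m = k
          · subst hmk
            simp only [Pi.add_apply, Pi.sub_apply, Pi.single_eq_same, Pi.single_eq_of_ne hki,
              hl, if_neg hki, if_pos hkT]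
            linarith
          · simp only [Pi.add_apply, Pi.sub_apply, Pi.single_eq_of_ne hmi,
              Pi.single_eq_of_ne hmk]
            linarith
      · intro m
        have h1 := hwu m
        by_cases hmi : m = i
        · subst hmi
          simp only [Pi.add_apply, Pi.sub_apply, Pi.single_eq_same, Pi.single_eq_of_ne hki.symm,
            hu, if_true]
          exact le_max_of_le_left (by linarith)
        · by_cases hmk : m = k
          · subst hmk
            simp only [Pi.add_apply, Pi.sub_apply, Pi.single_eq_same, Pi.single_eq_of_ne hki]
            linarith
          · simp only [Pi.add_apply, Pi.sub_apply, Pi.single_eq_of_ne hmi,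
              Pi.single_eq_of_ne hmk]
            linarith
    have h1 := hmax ⟨hm, hbox⟩
    simp only [Set.mem_ofPred_eq, Pi.add_apply, Pi.sub_apply, Pi.single_eq_same,
      Pi.single_eq_of_ne hki.symm] at h1
    linarith
  choose! D hD using hsep
  set V := T.filter (fun k => k ≠ i ∧ (a : ℝ) < c k + w k) with hV
  set Z := V.biUnion D ∩ T with hZ
  have hZt : Tight f w Z :=
    (Tight.union_inter hf hw (tight_biUnion hf hf0 hw V D fun k hk => (hD k hk).1) hTw).2
  have hiZ : i ∉ Z := by
    simp only [hZ, mem_inter, mem_biUnion, not_and]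
    rintro ⟨k, hk, hik⟩
    exact absurd hik (hD k hk).2.2
  have hrest : ∀ k ∈ (T \ Z).erase i, w k = ((a - c k : ℤ) : ℝ) := by
    intro k hk
    simp only [mem_erase, mem_sdiff] at hk
    obtain ⟨hki, hkT, hkZ⟩ := hk
    have h1 := (hwon k hkT hki).1
    by_contra hne
    have hkV : k ∈ V := by
      rw [hV, mem_filter]
      refine ⟨hkT, hki, lt_of_le_of_ne h1 fun h => hne ?_⟩
      push_cast
      linarith
    exact hkZ (mem_inter.2 ⟨mem_biUnion.2 ⟨k, hkV, (hD k hkV).2.1⟩, hkT⟩)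
  have hsum : w i = ((f T - f Z - ∑ k ∈ (T \ Z).erase i, (a - c k) : ℤ) : ℝ) := by
    have h1 := sum_sdiff (f := w) (inter_subset_right : Z ⊆ T)
    have h2 := add_sum_erase (T \ Z) w (mem_sdiff.2 ⟨hi, hiZ⟩)
    rw [sum_congr rfl hrest] at h2
    unfold Tight at hTw hZt
    push_cast at h2 ⊢
    linarith
  have h1 := ha i hi
  have h2 : (a : ℝ) < c i + w i := by linarith [hwi.1]
  rw [hsum] at h2 hlt
  have h3 : a < c i + (f T - f Z - ∑ k ∈ (T \ Z).erase i, (a - c k)) := by exact_mod_cast h2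
  have h4 : c i + (f T - f Z - ∑ k ∈ (T \ Z).erase i, (a - c k)) < a + 1 := by
    exact_mod_cast hlt
  omega

lemma exists_lower (hf : Supermodular f) (hf0 : f ∅ = 0) (hy : y ∈ basePoly f)
    (hU : Tight f y U) (c : N → ℤ) (a : ℤ) (ha : ∀ k ∉ U, (c k : ℝ) + y k < a)
    {i : N} (hi : i ∉ U) :
    ∃ y' ∈ basePoly f, (∀ k ∈ U, y' k = y k) ∧
      (∀ k ∉ U, k ≠ i → c k + y' k ≤ (a : ℝ) ∧ y k ≤ y' k) ∧
      c i + y' i ≤ (a : ℝ) - 1 ∧ y i - 1 < y' i := by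
  obtain ⟨w, hw, h1, h2, h3, h4⟩ := exists_raise (dual_supermodular hf) dual_empty
    (neg_mem_dual hf0 hy) (hU.neg_compl hy) (-c) (-a)
    (fun k hk => by
      have := ha k (by simpa using hk)
      simp only [Pi.neg_apply]
      push_cast
      linarith) (i := i) (by simpa using hi)
  refine ⟨-w, ?_, fun k hk => ?_, fun k hk hki => ?_, ?_, ?_⟩
  · have := neg_mem_dual dual_empty hw
    rwa [dual_dual hf0] at this
  · have := h1 k (by simpa using hk)
    simp [this]
  · have := h2 k (by simpa using hk) hki
    simp only [Pi.neg_apply] at this ⊢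
    push_cast at this
    constructor <;> linarith
  · simp only [Pi.neg_apply] at h3 ⊢
    push_cast at h3
    linarith
  · simp only [Pi.neg_apply] at h4 ⊢
    linarith

section SymmetricConvex

variable {Φ : (N → ℝ) → ℝ}

omit [Fintype N] in
/-- A Robin Hood transfer strictly decreases a symmetric strictly convex function. -/
lemma transfer_lt (hsym : ∀ (σ : Equiv.Perm N) (z : N → ℝ), Φ (z ∘ σ) = Φ z)
    (hconv : StrictConvexOn ℝ Set.univ Φ) (z : N → ℝ) {p q : N} {δ : ℝ} (hδ : 0 < δ)
    (hlt : δ < z p - z q) : Φ (z - Pi.single p δ + Pi.single q δ) < Φ z := by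
  have hpq : p ≠ q := by
    rintro rfl
    linarith
  have hpos : 0 < z p - z q := hδ.trans hlt
  have hne : z ≠ z ∘ Equiv.swap p q := by
    intro h
    have := congrFun h p
    simp only [Function.comp_apply, Equiv.swap_apply_left] at this
    linarith
  have ht : δ / (z p - z q) < 1 := (div_lt_one hpos).2 hlt
  have ht0 : 0 < δ / (z p - z q) := div_pos hδ hpos
  have h := hconv.2 (Set.mem_univ z) (Set.mem_univ (z ∘ Equiv.swap p q)) hne
    (sub_pos.2 ht) ht0 (by ring)
  rw [hsym] at h
  have heq : (1 - δ / (z p - z q)) • z + (δ / (z p - z q)) • (z ∘ Equiv.swap p q) =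
      z - Pi.single p δ + Pi.single q δ := by
    funext k
    simp only [Pi.add_apply, Pi.sub_apply, Pi.smul_apply, smul_eq_mul, Function.comp_apply]
    by_cases hkp : k = p
    · subst hkp
      rw [Equiv.swap_apply_left, Pi.single_eq_same, Pi.single_eq_of_ne hpq]
      field_simp
      ring
    · by_cases hkq : k = q
      · subst hkq
        rw [Equiv.swap_apply_right, Pi.single_eq_same, Pi.single_eq_of_ne hkp]
        field_simp
        ring
      · rw [Equiv.swap_apply_of_ne_of_ne hkp hkq, Pi.single_eq_of_ne hkp, Pi.single_eq_of_ne hkq]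
        ring
  rw [heq] at h
  simp only [smul_eq_mul] at h
  linarith

/-- Moving all coordinates towards a common level, with constant sum, strictly decreases a
symmetric strictly convex function. -/
lemma contract_lt (hsym : ∀ (σ : Equiv.Perm N) (z : N → ℝ), Φ (z ∘ σ) = Φ z)
    (hconv : StrictConvexOn ℝ Set.univ Φ) (a : ℝ) (z' : N → ℝ) :
    ∀ (n : ℕ) (z : N → ℝ), (univ.filter fun k => z' k ≠ z k).card ≤ n →
      ∑ k, z' k = ∑ k, z k →
      (∀ k, (a ≤ z' k ∧ z' k ≤ z k) ∨ (z k ≤ z' k ∧ z' k ≤ a)) → z' ≠ z → Φ z' < Φ z := by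
  intro n
  induction n with
  | zero =>
    intro z hcard _ _ hne
    refine absurd (funext fun k => ?_) hne
    by_contra hk
    have : k ∈ univ.filter fun k => z' k ≠ z k := by simpa using hk
    rw [card_eq_zero.1 (Nat.le_zero.1 hcard)] at this
    simp at this
  | succ n ih =>
    intro z hcard hsum hbox hne
    obtain ⟨p, hp⟩ : ∃ p, z' p < z p := by
      by_contra! h
      refine hne (funext fun k => ?_)
      exact (((sum_eq_sum_iff_of_le fun k _ => h k).1 hsum.symm) k (mem_univ k)).symm
    obtain ⟨q, hq⟩ : ∃ q, z q < z' q := by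
      by_contra! h
      refine hne (funext fun k => ?_)
      exact ((sum_eq_sum_iff_of_le fun k _ => h k).1 hsum) k (mem_univ k)
    have hpa : a ≤ z' p := by
      rcases hbox p with h | h <;> linarith
    have hqa : z' q ≤ a := by
      rcases hbox q with h | h <;> linarith
    have hpq : p ≠ q := by
      rintro rfl
      linarith
    set δ := min (z p - z' p) (z' q - z q) with hδ
    have hδ0 : 0 < δ := lt_min (by linarith) (by linarith)
    have hδ1 : δ ≤ z p - z' p := min_le_left _ _
    have hδ2 : δ ≤ z' q - z q := min_le_right _ _
    have hlt := transfer_lt hsym hconv z (p := p) (q := q) hδ0 (by linarith)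
    set w := z - Pi.single p δ + Pi.single q δ with hw
    have hwp : w p = z p - δ := by simp [hw, hpq]
    have hwq : w q = z q + δ := by simp [hw, hpq.symm]
    have hwk : ∀ k, k ≠ p → k ≠ q → w k = z k := by
      intro k h1 h2
      simp [hw, h1, h2]
    by_cases hzw : z' = w
    · rw [hzw]
      exact hlt
    refine (ih w ?_ ?_ ?_ hzw).trans hlt
    · have hss : (univ.filter fun k => z' k ≠ w k) ⊂ univ.filter fun k => z' k ≠ z k := by
        refine (ssubset_iff_of_subset ?_).2 ?_
        · intro k hk
          simp only [mem_filter, mem_univ, true_and] at hk ⊢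
          by_cases h1 : k = p
          · rw [h1]
            exact hp.ne
          · by_cases h2 : k = q
            · rw [h2]
              exact hq.ne'
            · rwa [hwk k h1 h2] at hk
        · rcases min_choice (z p - z' p) (z' q - z q) with h | h
          · refine ⟨p, by simpa using hp.ne, ?_⟩
            simp only [mem_filter, mem_univ, true_and, not_not, hwp, hδ, h]
            ring
          · refine ⟨q, by simpa using hq.ne', ?_⟩
            simp only [mem_filter, mem_univ, true_and, not_not, hwq, hδ, h]
            ring
      have := card_lt_card hss
      omega
    · rw [hsum, hw, sum_transfer]
      simp
    · intro k
      by_cases h1 : k = p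
      · rw [h1, hwp]
        exact Or.inl ⟨hpa, by linarith⟩
      · by_cases h2 : k = q
        · rw [h2, hwq]
          exact Or.inr ⟨by linarith, hqa⟩
        · rw [hwk k h1 h2]
          exact hbox k

/-- Upper level sets of a minimizer are tight. -/
lemma tight_of_isMin (hf : Supermodular f) (hf0 : f ∅ = 0) (hy : y ∈ basePoly f)
    (hsym : ∀ (σ : Equiv.Perm N) (z : N → ℝ), Φ (z ∘ σ) = Φ z)
    (hconv : StrictConvexOn ℝ Set.univ Φ) (c : N → ℝ)
    (hmin : ∀ w ∈ basePoly f, Φ (c + y) ≤ Φ (c + w)) (V : Finset N)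
    (hV : ∀ p ∈ V, ∀ q ∉ V, c q + y q < c p + y p) : Tight f y V := by
  refine tight_of_separated hf hf0 hy V fun p hp q hq => ?_
  by_contra hno
  obtain ⟨ε, hε, hεX⟩ := exists_pos_le_slack hy hno
  have hlt := hV p hp q hq
  set δ := min ε ((c p + y p - (c q + y q)) / 2) with hδ
  have hδ0 : 0 < δ := lt_min hε (by linarith)
  have hδ1 : δ ≤ ε := min_le_left _ _
  have hδ2 : δ ≤ (c p + y p - (c q + y q)) / 2 := min_le_right _ _
  have h1 := hmin _ (transfer_mem hy hδ0.le fun X hpX hqX => hδ1.trans (hεX X hpX hqX))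
  have h2 := transfer_lt hsym hconv (c + y) (p := p) (q := q) hδ0
    (by simp only [Pi.add_apply]; linarith)
  rw [← add_assoc, ← add_sub_assoc] at h1
  linarith

end SymmetricConvex

open Classical in
/-- The smallest tight set containing `R`. -/
noncomputable def tightHull (f : Finset N → ℤ) (y : N → ℝ) (R : Finset N) : Finset N :=
  (univ.filter fun X => R ⊆ X ∧ Tight f y X).inf id

lemma tight_tightHull (hf : Supermodular f) (hy : y ∈ basePoly f) (R : Finset N) :
    Tight f y (tightHull f y R) := by
  classical
  exact tight_inf hf hy _ _ fun _ hX => (mem_filter.1 hX).2.2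

lemma subset_tightHull (f : Finset N → ℤ) (y : N → ℝ) (R : Finset N) : R ⊆ tightHull f y R := by
  intro k hk
  simp only [tightHull, mem_inf, mem_filter, mem_univ, true_and, id]
  exact fun X hX => hX.1 hk

lemma tightHull_subset {R : Finset N} (hR : R ⊆ X) (hX : Tight f y X) : tightHull f y R ⊆ X := by
  intro k hk
  simp only [tightHull, mem_inf, mem_filter, mem_univ, true_and, id] at hk
  exact hk X ⟨hR, hX⟩

lemma exists_of_mem_tightHull (hf : Supermodular f) (hf0 : f ∅ = 0) (hy : y ∈ basePoly f)
    {R : Finset N} {l : N} (hl : l ∈ tightHull f y R) :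
    ∃ i ∈ R, ¬ ∃ X, Tight f y X ∧ i ∈ X ∧ l ∉ X := by
  by_contra! h
  choose! D hD using h
  have hsub : R ⊆ R.biUnion D := fun i hi => mem_biUnion.2 ⟨i, hi, (hD i hi).2.1⟩
  have := tightHull_subset hsub (tight_biUnion hf hf0 hy R D fun i hi => (hD i hi).1) hl
  obtain ⟨i, hi, hli⟩ := mem_biUnion.1 this
  exact (hD i hi).2.2 hli

/-- One round of growth by exchanges in `f` and then in `g`. -/
noncomputable def grow (f g : Finset N → ℤ) (x y : N → ℝ) (R : Finset N) : Finset N :=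
  tightHull g y (tightHull f x R)

lemma subset_iterate_grow (f g : Finset N → ℤ) (x y : N → ℝ) (T : Finset N) (n : ℕ) :
    T ⊆ (grow f g x y)^[n] T := by
  induction n with
  | zero => exact Subset.rfl
  | succ n ih =>
    rw [Function.iterate_succ_apply']
    exact ih.trans ((subset_tightHull _ _ _).trans (subset_tightHull _ _ _))

/-- Every element reached by alternating exchanges from `T` can be increased by one at the
expense of an element of `T`. -/
lemma exists_alternating_exchange (hf : Supermodular f) (hf0 : f ∅ = 0)
    (hg : Supermodular g) (hg0 : g ∅ = 0) {x : N → ℤ} (hx : (fun k => (x k : ℝ)) ∈ basePoly f)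
    (hy : y ∈ basePoly g) (hT : Tight g y T) (hU : Tight g y U) (hTU : T ⊆ U)
    (hint : ∀ k ∈ U, k ∉ T → ∃ n : ℤ, y k = n) :
    ∀ (n : ℕ) (R : Finset N), R = (grow f g (fun k => (x k : ℝ)) y)^[n] T → R ⊆ U →
      ∀ l ∈ tightHull f (fun k => (x k : ℝ)) R, l ∉ R →
      ∃ i ∈ T, ∃ x' : N → ℤ, ∃ y' : N → ℝ, (fun k => (x' k : ℝ)) ∈ basePoly f ∧
        y' ∈ basePoly g ∧ (∀ k ∉ tightHull f (fun k => (x k : ℝ)) R, x' k = x k) ∧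
        (∀ k ∉ R, y' k = y k) ∧ (∀ k ∈ T, y' k = y k) ∧
        ∀ k, x' k + y' k =
          x k + y k - (Pi.single i 1 : N → ℝ) k + (Pi.single l 1 : N → ℝ) k := by
  set xr : N → ℝ := fun k => (x k : ℝ) with hxr
  have hxstep : ∀ p q, (¬ ∃ X, Tight f xr X ∧ p ∈ X ∧ q ∉ X) →
      (fun k => ((x - Pi.single p 1 + Pi.single q 1 : N → ℤ) k : ℝ)) ∈ basePoly f := by
    intro p q hpq
    have h := unit_transfer_mem hf hx (tight_empty hf0) (tight_univ hx) (empty_subset _)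
      (fun k _ _ => ⟨x k, rfl⟩) (mem_univ p) (notMem_empty q) hpq
    convert h using 1
    funext k
    simp only [Pi.add_apply, Pi.sub_apply, Pi.single_apply]
    push_cast
    rfl
  have hcast : ∀ p k, (((Pi.single p 1 : N → ℤ) k : ℤ) : ℝ) = (Pi.single p 1 : N → ℝ) k := by
    intro p k
    simp only [Pi.single_apply]
    split_ifs <;> simp
  intro n
  induction n with
  | zero =>
    intro R hR hRU l hl hlR
    simp only [Function.iterate_zero, id] at hR
    subst hR
    obtain ⟨i, hi, hno⟩ := exists_of_mem_tightHull hf hf0 hx hl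
    refine ⟨i, hi, _, y, hxstep i l hno, hy, fun k hk => ?_, fun _ _ => rfl, fun _ _ => rfl,
      fun k => ?_⟩
    · have h1 : k ≠ i := fun h => hk (h ▸ subset_tightHull _ _ _ hi)
      have h2 : k ≠ l := fun h => hk (h ▸ hl)
      simp [h1, h2]
    · simp only [Pi.add_apply, Pi.sub_apply]
      push_cast
      rw [hcast, hcast]
      ring
  | succ n ih =>
    intro R hR hRU l hl hlR
    rw [Function.iterate_succ_apply'] at hR
    set R₀ := (grow f g xr y)^[n] T with hR₀
    set R₁ := tightHull f xr R₀ with hR₁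
    have hR₁t : Tight f xr R₁ := tight_tightHull hf hx _
    have h01 : R₀ ⊆ R₁ := subset_tightHull _ _ _
    have h1R : R₁ ⊆ R := hR ▸ subset_tightHull _ _ _
    have hTR₀ : T ⊆ R₀ := subset_iterate_grow _ _ _ _ _ n
    have hR₀t : Tight g y R₀ := by
      rw [hR₀]
      cases n with
      | zero => simpa using hT
      | succ n =>
        rw [Function.iterate_succ_apply']
        exact tight_tightHull hg hy _
    obtain ⟨k, hkR, hkno⟩ := exists_of_mem_tightHull hf hf0 hx hl
    have hlR₁ : l ∉ R₁ := fun h => hlR (h1R h)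
    have hkR₁ : k ∉ R₁ := fun h => hkno ⟨R₁, hR₁t, h, hlR₁⟩
    have hkR₀ : k ∉ R₀ := fun h => hkR₁ (h01 h)
    have hkR' := hkR
    rw [hR] at hkR'
    obtain ⟨j, hjR₁, hjno⟩ := exists_of_mem_tightHull hg hg0 hy hkR'
    have hjR₀ : j ∉ R₀ := fun h => hjno ⟨R₀, hR₀t, h, hkR₀⟩
    obtain ⟨i, hi, x', y', hx', hy', hx'off, hy'off, hy'T, hsum⟩ :=
      ih R₀ rfl (h01.trans (h1R.trans hRU)) j hjR₁ hjR₀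
    have hys := unit_transfer_mem hg hy hT hU hTU hint (hRU (h1R hjR₁))
      (fun h => hkR₀ (hTR₀ h)) hjno
    have hxs := hxstep k l hkno
    have hkl : k ∈ tightHull f xr R := subset_tightHull _ _ _ hkR
    refine ⟨i, hi, R₁.piecewise x' (x - Pi.single k 1 + Pi.single l 1),
      R₀.piecewise y' (y - Pi.single j 1 + Pi.single k 1), ?_, ?_, ?_, ?_, ?_, ?_⟩
    · have h := piecewise_mem hf hx' hxs (T := R₁)
        (hR₁t.congr_off hx hx' fun m hm => by rw [hx'off m hm])
        (hR₁t.congr_on fun m hm => by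
          have h1 : m ≠ k := fun h => hkR₁ (h ▸ hm)
          have h2 : m ≠ l := fun h => hlR₁ (h ▸ hm)
          simp [h1, h2, hxr])
      convert h using 1
      funext m
      by_cases hm : m ∈ R₁ <;> simp [hm]
    · exact piecewise_mem hg hy' hys (hR₀t.congr_off hy hy' hy'off)
        (hR₀t.congr_on fun m hm => by
          have h1 : m ≠ j := fun h => hjR₀ (h ▸ hm)
          have h2 : m ≠ k := fun h => hkR₀ (h ▸ hm)
          simp [h1, h2])
    · intro m hm
      have hmR₁ : m ∉ R₁ := fun h => hm (subset_tightHull _ _ _ (h1R h))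
      have h1 : m ≠ k := fun h => hm (h ▸ hkl)
      have h2 : m ≠ l := fun h => hm (h ▸ hl)
      simp [hmR₁, h1, h2]
    · intro m hm
      have hmR₀ : m ∉ R₀ := fun h => hm (h1R (h01 h))
      have h1 : m ≠ j := fun h => hm (h ▸ h1R hjR₁)
      have h2 : m ≠ k := fun h => hm (h ▸ hkR)
      simp [hmR₀, h1, h2]
    · intro m hm
      rw [piecewise_eq_of_mem _ _ _ (hTR₀ hm)]
      exact hy'T m hm
    · intro m
      have hs := hsum m
      by_cases hm1 : m ∈ R₁
      · have h1 : m ≠ k := fun h => hkR₁ (h ▸ hm1)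
        have h2 : m ≠ l := fun h => hlR₁ (h ▸ hm1)
        rw [piecewise_eq_of_mem _ _ _ hm1, Pi.single_eq_of_ne h2]
        by_cases hm0 : m ∈ R₀
        · have h3 : m ≠ j := fun h => hjR₀ (h ▸ hm0)
          rw [Pi.single_eq_of_ne h3] at hs
          rw [piecewise_eq_of_mem _ _ _ hm0, hs]
        · rw [piecewise_eq_of_notMem _ _ _ hm0]
          rw [hy'off m hm0] at hs
          simp only [Pi.add_apply, Pi.sub_apply, Pi.single_eq_of_ne h1]
          linarith
      · have hm0 : m ∉ R₀ := fun h => hm1 (h01 h)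
        have h3 : m ≠ j := fun h => hm1 (h ▸ hjR₁)
        have h4 : m ≠ i := fun h => hm0 (hTR₀ (h ▸ hi))
        rw [piecewise_eq_of_notMem _ _ _ hm0, piecewise_eq_of_notMem _ _ _ hm1]
        simp only [Pi.add_apply, Pi.sub_apply, Pi.single_eq_of_ne h3, Pi.single_eq_of_ne h4]
        push_cast
        rw [hcast, hcast]
        ring

/-- Either alternating exchanges from `T` leave `U`, or `T` and `U` are separated by a set that
is tight for both functions. -/
lemma exists_common_tight_or_exit (hf : Supermodular f) (hg : Supermodular g) {x : N → ℝ}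
    (hx : x ∈ basePoly f) (hy : y ∈ basePoly g) (hU : Tight g y U) (hTU : T ⊆ U) :
    (∃ R, T ⊆ R ∧ R ⊆ U ∧ Tight f x R ∧ Tight g y R) ∨
      ∃ n, (grow f g x y)^[n] T ⊆ U ∧ ∃ l ∈ tightHull f x ((grow f g x y)^[n] T), l ∉ U := by
  by_contra! hcon
  obtain ⟨hno, hstay⟩ := hcon
  have hsub : ∀ n, (grow f g x y)^[n] T ⊆ U := by
    intro n
    induction n with
    | zero => exact hTU
    | succ n ih =>
      rw [Function.iterate_succ_apply']
      exact tightHull_subset (fun l hl => hstay n ih l hl) hU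
  have hcard : ∀ n, n ≤ ((grow f g x y)^[n] T).card := by
    intro n
    induction n with
    | zero => exact Nat.zero_le _
    | succ n ih =>
      rw [Function.iterate_succ_apply']
      set R := (grow f g x y)^[n] T with hR
      have h1 : R ⊆ tightHull f x R := subset_tightHull _ _ _
      have h2 : tightHull f x R ⊆ grow f g x y R := subset_tightHull _ _ _
      have hne : R ≠ grow f g x y R := by
        intro h
        have h3 : tightHull f x R = R := (h2.trans h.symm.subset).antisymm h1
        refine hno R (subset_iterate_grow _ _ _ _ _ n) (hsub n) ?_ ?_
        · have := tight_tightHull hf hx R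
          rwa [h3] at this
        · rw [h]
          exact tight_tightHull hg hy _
      have := card_lt_card ((h1.trans h2).ssubset_of_ne hne)
      omega
  have := hcard (Fintype.card N + 1)
  have := card_le_univ ((grow f g x y)^[Fintype.card N + 1] T)
  omega

omit [DecidableEq N] in
lemma cast_mem_basePoly {x : N → ℤ} : (fun k => (x k : ℝ)) ∈ basePoly f ↔ x ∈ MSet f := by
  simp only [basePoly, MSet, Set.mem_ofPred_eq]
  norm_cast

omit [DecidableEq N] in
lemma add_mem_basePoly {x : N → ℝ} (hx : x ∈ basePoly f) (hy : y ∈ basePoly g) :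
    (fun k => x k + y k) ∈ basePoly fun X => f X + g X := by
  refine ⟨?_, fun X => ?_⟩
  · rw [sum_add_distrib, hx.1, hy.1]
    push_cast
    rfl
  · rw [sum_add_distrib]
    push_cast
    exact add_le_add (hx.2 X) (hy.2 X)

omit [Fintype N] in
lemma Supermodular.add (hf : Supermodular f) (hg : Supermodular g) :
    Supermodular fun X => f X + g X := by
  intro X Y
  have h1 := hf X Y
  have h2 := hg X Y
  simp only
  linarith

theorem le_ceil_of_isMin {fM fC : Finset N → ℤ}
    (hM : Supermodular fM) (hM0 : fM ∅ = 0) (hC : Supermodular fC) (hC0 : fC ∅ = 0)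
    {Φ : (N → ℝ) → ℝ} (hsym : ∀ (σ : Equiv.Perm N) (z : N → ℝ), Φ (z ∘ σ) = Φ z)
    (hconv : StrictConvexOn ℝ Set.univ Φ)
    {zs : N → ℝ} (hzs : zs ∈ BE fM fC) (hmin : ∀ z ∈ BE fM fC, Φ zs ≤ Φ z)
    {zbar : N → ℝ} (hzbar : zbar ∈ basePoly (fun X => fM X + fC X))
    (hbarmin : ∀ z ∈ basePoly (fun X => fM X + fC X), Φ zbar ≤ Φ z) (i₀ : N) :
    zs i₀ ≤ (⌈zbar i₀⌉ : ℝ) := by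
  classical
  by_contra! hlt
  set a : ℤ := ⌈zbar i₀⌉ with ha
  have hai : zbar i₀ ≤ a := Int.le_ceil _
  obtain ⟨x, hxM, y, hy, rfl⟩ := hzs
  have hx := cast_mem_basePoly.2 hxM
  have hymin : ∀ w ∈ basePoly fC, Φ ((fun k => (x k : ℝ)) + y) ≤ Φ ((fun k => (x k : ℝ)) + w) :=
    fun w hw => hmin _ ⟨x, hxM, w, hw, rfl⟩
  set T : Finset N := univ.filter fun k => (a : ℝ) < x k + y k with hTdef
  set U : Finset N := univ.filter fun k => (a : ℝ) ≤ x k + y k with hUdef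
  have memT : ∀ k, k ∈ T ↔ (a : ℝ) < x k + y k := by simp [hTdef]
  have memU : ∀ k, k ∈ U ↔ (a : ℝ) ≤ x k + y k := by simp [hUdef]
  have hTU : T ⊆ U := fun k hk => (memU k).2 ((memT k).1 hk).le
  have hT : Tight fC y T := tight_of_isMin hC hC0 hy hsym hconv _ hymin T fun p hp q hq => by
    rw [memT] at hp hq
    linarith
  have hU : Tight fC y U := tight_of_isMin hC hC0 hy hsym hconv _ hymin U fun p hp q hq => by
    rw [memU] at hp hq
    linarith
  have hzE := add_mem_basePoly hx hy
  rcases exists_common_tight_or_exit hM hC hx hy hU hTU (T := T) with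
    ⟨R, hTR, hRU, hRx, hRy⟩ | ⟨n, hRU, l, hl, hlU⟩
  · set L : Finset N := univ.filter fun k => (a : ℝ) < zbar k with hLdef
    have memL : ∀ k, k ∈ L ↔ (a : ℝ) < zbar k := by simp [hLdef]
    have hL : Tight (fun X => fM X + fC X) zbar L :=
      tight_of_isMin (hM.add hC) (by simp [hM0, hC0]) hzbar hsym hconv 0
        (fun w hw => by simpa using hbarmin w hw) L fun p hp q hq => by
          rw [memL] at hp hq
          simp only [Pi.zero_apply]
          linarith
    have h1 : ∑ k ∈ R, ((x k : ℝ) + y k - zbar k) ≤ 0 := by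
      have := hzbar.2 R
      push_cast at this
      unfold Tight at hRx hRy
      rw [sum_sub_distrib, sum_add_distrib]
      linarith
    have h2 : 0 ≤ ∑ k ∈ L, ((x k : ℝ) + y k - zbar k) := by
      have h3 := hzE.2 L
      unfold Tight at hL
      rw [sum_sub_distrib]
      linarith
    have h3 := sum_inter_add_sum_sdiff R L (fun k => (x k : ℝ) + y k - zbar k)
    have h4 := sum_inter_add_sum_sdiff L R (fun k => (x k : ℝ) + y k - zbar k)
    rw [inter_comm] at h4
    have h5 : ∑ k ∈ L \ R, ((x k : ℝ) + y k - zbar k) ≤ 0 := by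
      refine sum_nonpos fun k hk => ?_
      rw [mem_sdiff, memL] at hk
      have h6 : k ∉ T := fun h => hk.2 (hTR h)
      rw [memT] at h6
      linarith
    have h6 : 0 < ∑ k ∈ R \ L, ((x k : ℝ) + y k - zbar k) := by
      refine sum_pos' (fun k hk => ?_) ⟨i₀, ?_, by linarith⟩
      · rw [mem_sdiff, memL] at hk
        have h7 := (memU k).1 (hRU hk.1)
        linarith
      · rw [mem_sdiff, memL]
        exact ⟨hTR ((memT _).2 hlt), by linarith⟩
    linarith
  · have hint : ∀ k ∈ U, k ∉ T → ∃ n : ℤ, y k = n := by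
      intro k hkU hkT
      rw [memU] at hkU
      rw [memT] at hkT
      refine ⟨a - x k, ?_⟩
      push_cast
      linarith
    obtain ⟨i, hi, x', y', hx', hy', -, hy'off, hy'T, hsum⟩ :=
      exists_alternating_exchange hM hM0 hC hC0 hx hy hT hU hTU hint n _ rfl hRU l hl
        fun h => hlU (hRU h)
    obtain ⟨yT, hyT, hyT1, hyT2, hyT3, hyT4⟩ :=
      exists_raise hC hC0 hy hT x a (fun k hk => (memT k).1 hk) hi
    obtain ⟨yS, hyS, hyS1, hyS2, hyS3, hyS4⟩ :=
      exists_lower hC hC0 hy hU x a (fun k hk => not_le.1 fun h => hk ((memU k).2 h)) hlU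
    have hg1 : T.piecewise yT y' ∈ basePoly fC :=
      piecewise_mem hC hyT hy' (hT.congr_off hy hyT hyT1) (hT.congr_on hy'T)
    have hg2 : U.piecewise (T.piecewise yT y') yS ∈ basePoly fC := by
      refine piecewise_mem hC hg1 hyS (hU.congr_off hy hg1 fun k hk => ?_) (hU.congr_on hyS1)
      rw [piecewise_eq_of_notMem _ _ _ fun h => hk (hTU h)]
      exact hy'off k fun h => hk (hRU h)
    set w := U.piecewise (T.piecewise yT y') yS with hw
    have hiU := hTU hi
    have hil : i ≠ l := fun h => hlU (h ▸ hiU)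
    have hzi : (x' i : ℝ) + w i = x i + yT i - 1 := by
      have := hsum i
      rw [hy'T i hi, Pi.single_eq_same, Pi.single_eq_of_ne hil] at this
      rw [hw, piecewise_eq_of_mem _ _ _ hiU, piecewise_eq_of_mem _ _ _ hi]
      linarith
    have hbox : ∀ k, ((a : ℝ) ≤ x' k + w k ∧ x' k + w k ≤ x k + y k) ∨
        ((x k : ℝ) + y k ≤ x' k + w k ∧ x' k + w k ≤ a) := by
      intro k
      by_cases hki : k = i
      · subst hki
        rw [hzi]
        exact Or.inl ⟨by linarith, by linarith⟩
      have hs := hsum k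
      rw [Pi.single_eq_of_ne hki] at hs
      by_cases hkU : k ∈ U
      · have hkl : k ≠ l := fun h => hlU (h ▸ hkU)
        rw [Pi.single_eq_of_ne hkl] at hs
        rw [hw, piecewise_eq_of_mem _ _ _ hkU]
        by_cases hkT : k ∈ T
        · rw [piecewise_eq_of_mem _ _ _ hkT]
          rw [hy'T k hkT] at hs
          have := hyT2 k hkT hki
          exact Or.inl ⟨by linarith, by linarith⟩
        · rw [piecewise_eq_of_notMem _ _ _ hkT]
          have := (memU k).1 hkU
          exact Or.inl ⟨by linarith, by linarith⟩
      · rw [hy'off k fun h => hkU (hRU h)] at hs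
        rw [hw, piecewise_eq_of_notMem _ _ _ hkU]
        by_cases hkl : k = l
        · subst hkl
          rw [Pi.single_eq_same] at hs
          exact Or.inr ⟨by linarith, by linarith⟩
        · rw [Pi.single_eq_of_ne hkl] at hs
          have := hyS2 k hkU hkl
          exact Or.inr ⟨by linarith, by linarith⟩
    have hne : (fun k => (x' k : ℝ) + w k) ≠ fun k => (x k : ℝ) + y k := by
      intro h
      have := congrFun h i
      linarith
    have hlt' := contract_lt hsym hconv a _ _ _ le_rfl
      ((add_mem_basePoly hx' hg2).1.trans hzE.1.symm) hbox hne
    have := hmin _ ⟨x', cast_mem_basePoly.1 hx', w, hg2, rfl⟩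
    linarith

lemma neg_mem_BE_dual {fM fC : Finset N → ℤ} (hM0 : fM ∅ = 0) (hC0 : fC ∅ = 0)
    (hz : z ∈ BE fM fC) : -z ∈ BE (dual fM) (dual fC) := by
  obtain ⟨x, hx, y, hy, rfl⟩ := hz
  refine ⟨-x, cast_mem_basePoly.1 ?_, -y, neg_mem_dual hC0 hy, ?_⟩
  · convert neg_mem_dual hM0 (cast_mem_basePoly.2 hx) using 1
    funext k
    simp
  · funext k
    simp only [Pi.neg_apply]
    push_cast
    ring

end BasePolyhedron

/-- proximity theorem: any Φ-minimizer `z*` over `B_E` lies in the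
unit box around the unique Φ-minimizer `z̄` over the base-polyhedron of `f_E = f_M + f_C`. -/
theorem stmt_12 {N : Type*} [Fintype N] [DecidableEq N]
    (fM fC : Finset N → ℤ)
    (hM : ∀ X Y : Finset N, fM X + fM Y ≤ fM (X ∪ Y) + fM (X ∩ Y)) (hM0 : fM ∅ = 0)
    (hC : ∀ X Y : Finset N, fC X + fC Y ≤ fC (X ∪ Y) + fC (X ∩ Y)) (hC0 : fC ∅ = 0)
    (Φ : (N → ℝ) → ℝ)
    (hsym : ∀ (σ : Equiv.Perm N) (z : N → ℝ), Φ (z ∘ σ) = Φ z)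
    (hconv : StrictConvexOn ℝ Set.univ Φ)
    (zs : N → ℝ) (hzs : zs ∈ BE fM fC)
    (hmin : ∀ z ∈ BE fM fC, Φ zs ≤ Φ z)
    (zbar : N → ℝ) (hzbar : zbar ∈ basePoly (fun X => fM X + fC X))
    (hbarmin : ∀ z ∈ basePoly (fun X => fM X + fC X), Φ zbar ≤ Φ z) :
    ∀ i : N, (⌊zbar i⌋ : ℝ) ≤ zs i ∧ zs i ≤ (⌈zbar i⌉ : ℝ) := by
  have hE0 : (fun X => fM X + fC X) (∅ : Finset N) = 0 := by simp [hM0, hC0]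
  have hdual : (fun X => BasePolyhedron.dual fM X + BasePolyhedron.dual fC X) =
      BasePolyhedron.dual fun X => fM X + fC X := by
    funext X
    simp only [BasePolyhedron.dual]
    ring
  intro i
  refine ⟨?_, BasePolyhedron.le_ceil_of_isMin hM hM0 hC hC0 hsym hconv hzs hmin hzbar hbarmin i⟩
  have hconv' : StrictConvexOn ℝ Set.univ fun z : N → ℝ => Φ (-z) := by
    refine ⟨convex_univ, fun u _ v _ huv s t hs ht hst => ?_⟩
    have h := hconv.2 (Set.mem_univ (-u)) (Set.mem_univ (-v)) (neg_injective.ne huv) hs ht hst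
    convert h using 2
    simp only [smul_neg, neg_add]
  have h := BasePolyhedron.le_ceil_of_isMin (BasePolyhedron.dual_supermodular hM)
    BasePolyhedron.dual_empty (BasePolyhedron.dual_supermodular hC) BasePolyhedron.dual_empty
    (Φ := fun z => Φ (-z)) (fun σ z => hsym σ (-z)) hconv'
    (BasePolyhedron.neg_mem_BE_dual hM0 hC0 hzs)
    (fun z hz => by
      have h1 := BasePolyhedron.neg_mem_BE_dual BasePolyhedron.dual_empty
        BasePolyhedron.dual_empty hz
      rw [BasePolyhedron.dual_dual hM0, BasePolyhedron.dual_dual hC0] at h1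
      simpa using hmin _ h1)
    (zbar := -zbar) (by
      rw [hdual]
      exact BasePolyhedron.neg_mem_dual hE0 hzbar)
    (fun z hz => by
      rw [hdual] at hz
      have h1 := BasePolyhedron.neg_mem_dual BasePolyhedron.dual_empty hz
      rw [BasePolyhedron.dual_dual hE0] at h1
      simpa using hbarmin _ h1) i
  simp only [Pi.neg_apply, Int.ceil_neg, Int.cast_neg] at h
  linarith
end
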